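/- Let G be an L⁰-convexly compact subset of L⁰(𝓕,B) that has random normal structure, and let 𝒯 be a family of nonexpansive mappings from G to G such that T∘S = S∘T for all T, S ∈ 𝒯 and such that for each T ∈ 𝒯 the closure of T(G) under convergence in probability equals G. Then 𝒯 has a common fixed point lying in the random Chebyshev center C(G,G). -/

import Mathlib

open MeasureTheory Set Filter Function
open scoped Classical

noncomputable section

namespace RNM


variable {Ω : Type*} [MeasurableSpace Ω] {P : Measure Ω}
variable {B : Type*} [NormedAddCommGroup B] [NormedSpace ℝ B]

/-- The pointwise norm of `x ∈ L⁰(𝓕,B)` as an element of `L⁰(𝓕,ℝ)`. -/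
def nrm (x : Ω →ₘ[P] B) : Ω →ₘ[P] ℝ := x.comp norm continuous_norm

/-- The module action of `L⁰(𝓕,ℝ)` on `L⁰(𝓕,B)` (pointwise scalar multiplication). -/
def msmul (l : Ω →ₘ[P] ℝ) (x : Ω →ₘ[P] B) : Ω →ₘ[P] B :=
  AEEqFun.comp₂ (fun c (b : B) => c • b) continuous_smul l x

/-- `Ĩ_A`, the equivalence class of the indicator function of `A`, in `L⁰(𝓕,ℝ)`. -/
def ind (A : Set Ω) (hA : MeasurableSet A) : Ω →ₘ[P] ℝ :=
  AEEqFun.mk (A.indicator fun _ => (1 : ℝ))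
    ((measurable_const.indicator hA).aestronglyMeasurable)

/-- A subset of `L⁰(𝓕,B)` is a.s. bounded if the norms of its members have a common
bound in `L⁰(𝓕,ℝ)`. -/
def ASBounded (H : Set (Ω →ₘ[P] B)) : Prop :=
  ∃ ξ : Ω →ₘ[P] ℝ, ∀ h ∈ H, nrm h ≤ ξ

/-- The supremum of a subset of `L⁰(𝓕,ℝ)` (junk value `0` if no least upper bound exists;
for nonempty a.s. bounded-above sets the least upper bound always exists, by Dedekind
completeness of `L⁰(𝓕,ℝ)`). -/
def lsup (S : Set (Ω →ₘ[P] ℝ)) : Ω →ₘ[P] ℝ :=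
  if h : ∃ ξ, IsLUB S ξ then h.choose else 0

/-- The infimum of a subset of `L⁰(𝓕,ℝ)` (junk value `0` if no greatest lower bound exists). -/
def linf (S : Set (Ω →ₘ[P] ℝ)) : Ω →ₘ[P] ℝ :=
  if h : ∃ ξ, IsGLB S ξ then h.choose else 0

/-- The random Chebyshev radius `R(H,x)` of `H` at `x`. -/
def Rr (H : Set (Ω →ₘ[P] B)) (x : Ω →ₘ[P] B) : Ω →ₘ[P] ℝ :=
  lsup ((fun y => nrm (x - y)) '' H)

/-- The random Chebyshev radius `R(H,G)` of `H` with respect to `G`. -/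
def RrS (H G : Set (Ω →ₘ[P] B)) : Ω →ₘ[P] ℝ :=
  linf ((fun x => Rr H x) '' G)

/-- The random Chebyshev center `C(H,G)` of `H` with respect to `G`. -/
def Cc (H G : Set (Ω →ₘ[P] B)) : Set (Ω →ₘ[P] B) :=
  {x ∈ G | Rr H x = RrS H G}

/-- The random diameter `D(H)`. -/
def Dd (H : Set (Ω →ₘ[P] B)) : Ω →ₘ[P] ℝ :=
  lsup {ξ | ∃ x ∈ H, ∃ y ∈ H, ξ = nrm (x - y)}

/-- A subset of `L⁰(𝓕,B)` is closed if it is sequentially closed under convergence in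
probability (the `(ε,λ)`-topology). -/
def SeqClosed (S : Set (Ω →ₘ[P] B)) : Prop :=
  ∀ (x : ℕ → Ω →ₘ[P] B) (y : Ω →ₘ[P] B), (∀ n, x n ∈ S) →
    TendstoInMeasure P (fun n => (x n : Ω → B)) atTop y → y ∈ S

/-- The closure of a subset of `L⁰(𝓕,B)` under convergence in probability. -/
def seqClosure (S : Set (Ω →ₘ[P] B)) : Set (Ω →ₘ[P] B) :=
  {y | ∃ x : ℕ → Ω →ₘ[P] B, (∀ n, x n ∈ S) ∧
    TendstoInMeasure P (fun n => (x n : Ω → B)) atTop y}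

/-- `L⁰`-convexity. -/
def LConvex (G : Set (Ω →ₘ[P] B)) : Prop :=
  ∀ x ∈ G, ∀ y ∈ G, ∀ l : Ω →ₘ[P] ℝ, 0 ≤ l → l ≤ 1 →
    msmul l x + msmul (1 - l) y ∈ G

/-- `L⁰`-convex compactness: `G` is a nonempty closed `L⁰`-convex set such that every family
of nonempty closed `L⁰`-convex subsets of `G` with the finite intersection property has
nonempty intersection. -/
def ConvexlyCompact (G : Set (Ω →ₘ[P] B)) : Prop :=
  G.Nonempty ∧ SeqClosed G ∧ LConvex G ∧
    ∀ 𝒞 : Set (Set (Ω →ₘ[P] B)),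
      (∀ C ∈ 𝒞, C.Nonempty ∧ C ⊆ G ∧ SeqClosed C ∧ LConvex C) →
      (∀ S : Finset (Set (Ω →ₘ[P] B)), ↑S ⊆ 𝒞 → (⋂₀ (S : Set (Set (Ω →ₘ[P] B)))).Nonempty) →
      (⋂₀ 𝒞).Nonempty

/-- Random normal structure. -/
def RandNormalStructure (G : Set (Ω →ₘ[P] B)) : Prop :=
  ∀ H ⊆ G, H.Nonempty → ASBounded H → SeqClosed H → LConvex H → Dd H ≠ 0 →
    ∃ z ∈ H, ∀ᵐ ω ∂P, 0 < Dd H ω → Rr H z ω < Dd H ω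

/-- A nonexpansive mapping (on `G`). -/
def NonexpansiveOn (G : Set (Ω →ₘ[P] B)) (T : (Ω →ₘ[P] B) → (Ω →ₘ[P] B)) : Prop :=
  ∀ x ∈ G, ∀ y ∈ G, nrm (T x - T y) ≤ nrm (x - y)

/-- An isometric mapping (on `G`). -/
def IsometricOn (G : Set (Ω →ₘ[P] B)) (T : (Ω →ₘ[P] B) → (Ω →ₘ[P] B)) : Prop :=
  ∀ x ∈ G, ∀ y ∈ G, nrm (T x - T y) = nrm (x - y)

/-- A countable measurable partition of `Ω`. -/
def IsPartition (A : ℕ → Set Ω) : Prop :=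
  (∀ n, MeasurableSet (A n)) ∧ Pairwise (Disjoint on A) ∧ (⋃ n, A n) = univ

/-- `y` is the countable concatenation `Σ_n Ĩ_{A_n} x_n`,
i.e. `y` agrees a.s. with `x n` on `A n` for each `n`. -/
def IsConcat (A : ℕ → Set Ω) (x : ℕ → Ω →ₘ[P] B) (y : Ω →ₘ[P] B) : Prop :=
  ∀ n, ∀ᵐ ω ∂P, ω ∈ A n → y ω = x n ω

/-- `G` is σ-stable: it contains all countable concatenations of its members along
countable measurable partitions of `Ω`. -/
def SigmaStable (G : Set (Ω →ₘ[P] B)) : Prop :=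
  ∀ A : ℕ → Set Ω, IsPartition A → ∀ x : ℕ → Ω →ₘ[P] B, (∀ n, x n ∈ G) →
    ∀ y, IsConcat A x y → y ∈ G

/-- The σ-stable hull of `G`. -/
def sigmaHull (G : Set (Ω →ₘ[P] B)) : Set (Ω →ₘ[P] B) :=
  {y | ∃ A : ℕ → Set Ω, IsPartition A ∧
    ∃ x : ℕ → Ω →ₘ[P] B, (∀ n, x n ∈ G) ∧ IsConcat A x y}

/-- The countable concatenation `Σ_n Ĩ_{A_n} H_n` of a sequence of sets. -/
def concatSet (A : ℕ → Set Ω) (H : ℕ → Set (Ω →ₘ[P] B)) : Set (Ω →ₘ[P] B) :=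
  {y | ∃ x : ℕ → Ω →ₘ[P] B, (∀ n, x n ∈ H n) ∧ IsConcat A x y}

/-- A finitely stable subset of `L⁰(𝓕,B)`. -/
def FinStable (G : Set (Ω →ₘ[P] B)) : Prop :=
  ∀ x ∈ G, ∀ y ∈ G, ∀ A : Set Ω, ∀ hA : MeasurableSet A,
    msmul (ind A hA) x + msmul (ind Aᶜ hA.compl) y ∈ G


set_option linter.unusedSectionVars false

open scoped Topology ENNReal

theorem le_iff_ae (f g : Ω →ₘ[P] ℝ) : f ≤ g ↔ ∀ᵐ ω ∂P, f ω ≤ g ω := AEEqFun.coeFn_le.symm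

theorem nrm_ae (x : Ω →ₘ[P] B) : ∀ᵐ ω ∂P, nrm x ω = ‖x ω‖ := AEEqFun.coeFn_comp _ _ _

theorem msmul_ae (l : Ω →ₘ[P] ℝ) (x : Ω →ₘ[P] B) :
    ∀ᵐ ω ∂P, msmul l x ω = l ω • x ω := AEEqFun.coeFn_comp₂ _ _ _ _

theorem sub_ae (x y : Ω →ₘ[P] B) : ∀ᵐ ω ∂P, (x - y) ω = x ω - y ω := AEEqFun.coeFn_sub x y

theorem add_ae (x y : Ω →ₘ[P] B) : ∀ᵐ ω ∂P, (x + y) ω = x ω + y ω := AEEqFun.coeFn_add x y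

theorem smul_ae (c : ℝ) (x : Ω →ₘ[P] B) : ∀ᵐ ω ∂P, (c • x) ω = c • x ω := AEEqFun.coeFn_smul c x

theorem nsub_ae (x y : Ω →ₘ[P] B) : ∀ᵐ ω ∂P, nrm (x - y) ω = ‖x ω - y ω‖ := by
  filter_upwards [nrm_ae (x - y), sub_ae x y] with ω h1 h2
  rw [h1, h2]

theorem nsub_le_iff (x y : Ω →ₘ[P] B) (c : Ω →ₘ[P] ℝ) :
    nrm (x - y) ≤ c ↔ ∀ᵐ ω ∂P, ‖x ω - y ω‖ ≤ c ω := by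
  rw [le_iff_ae]
  constructor
  · intro h
    filter_upwards [h, nsub_ae x y] with ω h1 h2
    rwa [← h2]
  · intro h
    filter_upwards [h, nsub_ae x y] with ω h1 h2
    rwa [h2]

theorem nsub_comm (x y : Ω →ₘ[P] B) : nrm (x - y) = nrm (y - x) := by
  apply AEEqFun.ext
  filter_upwards [nsub_ae x y, nsub_ae y x] with ω h1 h2
  rw [h1, h2, norm_sub_rev]

theorem comb_ae (l : Ω →ₘ[P] ℝ) (x y : Ω →ₘ[P] B) :
    ∀ᵐ ω ∂P, (msmul l x + msmul (1 - l) y) ω = l ω • x ω + (1 - l ω) • y ω := by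
  filter_upwards [add_ae (msmul l x) (msmul (1 - l) y), msmul_ae l x, msmul_ae (1 - l) y,
    AEEqFun.coeFn_sub 1 l, AEEqFun.coeFn_one (α := Ω) (β := ℝ) (μ := P)] with ω h1 h2 h3 h4 h5
  rw [h1, h2, h3, h4]
  simp [h5]

/-! closed balls -/

def Ball (a : Ω →ₘ[P] B) (c : Ω →ₘ[P] ℝ) : Set (Ω →ₘ[P] B) := {z | nrm (a - z) ≤ c}

theorem ball_closed (a : Ω →ₘ[P] B) (c : Ω →ₘ[P] ℝ) : SeqClosed (Ball a c) := by
  intro x y hx hy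
  obtain ⟨ns, -, hns⟩ := hy.exists_seq_tendsto_ae
  have h1 : ∀ᵐ ω ∂P, ∀ n, ‖a ω - x n ω‖ ≤ c ω :=
    ae_all_iff.2 fun n => (nsub_le_iff _ _ _).1 (hx n)
  refine (nsub_le_iff _ _ _).2 ?_
  filter_upwards [h1, hns] with ω h2 h3
  exact le_of_tendsto ((tendsto_const_nhds.sub h3).norm) (Eventually.of_forall fun n => h2 _)

theorem l01 {l : Ω →ₘ[P] ℝ} (h0 : 0 ≤ l) (h1 : l ≤ 1) : ∀ᵐ ω ∂P, 0 ≤ l ω ∧ l ω ≤ 1 := by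
  filter_upwards [(le_iff_ae _ _).1 h0, (le_iff_ae _ _).1 h1,
    AEEqFun.coeFn_one (α := Ω) (β := ℝ) (μ := P), AEEqFun.coeFn_zero (α := Ω) (β := ℝ) (μ := P)]
    with ω a b c d
  rw [c] at b
  rw [d] at a
  exact ⟨a, b⟩

theorem ball_conv (a : Ω →ₘ[P] B) (c : Ω →ₘ[P] ℝ) : LConvex (Ball a c) := by
  intro x hx y hy l h0 h1
  refine (nsub_le_iff _ _ _).2 ?_
  filter_upwards [(nsub_le_iff _ _ _).1 hx, (nsub_le_iff _ _ _).1 hy, comb_ae l x y, l01 h0 h1]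
    with ω h2 h3 h4 h5
  rw [h4]
  have : a ω - (l ω • x ω + (1 - l ω) • y ω) = l ω • (a ω - x ω) + (1 - l ω) • (a ω - y ω) := by
    module
  rw [this]
  calc _ ≤ ‖l ω • (a ω - x ω)‖ + ‖(1 - l ω) • (a ω - y ω)‖ := norm_add_le _ _
    _ = l ω * ‖a ω - x ω‖ + (1 - l ω) * ‖a ω - y ω‖ := by
      rw [norm_smul, norm_smul, Real.norm_of_nonneg h5.1, Real.norm_of_nonneg (by linarith [h5.2])]
    _ ≤ l ω * c ω + (1 - l ω) * c ω := by
      have := h5.1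
      have : 0 ≤ 1 - l ω := by linarith [h5.2]
      gcongr
    _ = c ω := by ring

theorem sInter_closed {F : Set (Set (Ω →ₘ[P] B))} (h : ∀ C ∈ F, SeqClosed C) :
    SeqClosed (⋂₀ F) := fun x y hx hy C hC => h C hC x y (fun n => hx n C hC) hy

theorem sInter_conv {F : Set (Set (Ω →ₘ[P] B))} (h : ∀ C ∈ F, LConvex C) :
    LConvex (⋂₀ F) := fun x hx y hy l h0 h1 C hC => h C hC x (hx C hC) y (hy C hC) l h0 h1

theorem inter_closed {C D : Set (Ω →ₘ[P] B)} (h : SeqClosed C) (h' : SeqClosed D) :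
    SeqClosed (C ∩ D) :=
  fun x y hx hy => ⟨h x y (fun n => (hx n).1) hy, h' x y (fun n => (hx n).2) hy⟩

theorem inter_conv {C D : Set (Ω →ₘ[P] B)} (h : LConvex C) (h' : LConvex D) :
    LConvex (C ∩ D) := fun x hx y hy l h0 h1 =>
  ⟨h x hx.1 y hy.1 l h0 h1, h' x hx.2 y hy.2 l h0 h1⟩

/-- points of `K` within `c` of every point of `H` -/
theorem cheb_closed {K : Set (Ω →ₘ[P] B)} (hK : SeqClosed K) (H : Set (Ω →ₘ[P] B))
    (c : Ω →ₘ[P] ℝ) : SeqClosed {x ∈ K | ∀ y ∈ H, nrm (y - x) ≤ c} :=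
  fun x z hx hz => ⟨hK x z (fun n => (hx n).1) hz,
    fun y hy => ball_closed y c x z (fun n => (hx n).2 y hy) hz⟩

theorem cheb_conv {K : Set (Ω →ₘ[P] B)} (hK : LConvex K) (H : Set (Ω →ₘ[P] B))
    (c : Ω →ₘ[P] ℝ) : LConvex {x ∈ K | ∀ y ∈ H, nrm (y - x) ≤ c} :=
  fun x hx z hz l h0 h1 => ⟨hK x hx.1 z hz.1 l h0 h1,
    fun y hy => ball_conv y c x (hx.2 y hy) z (hz.2 y hy) l h0 h1⟩

def hull (X : Set (Ω →ₘ[P] B)) : Set (Ω →ₘ[P] B) :=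
  ⋂₀ {C | SeqClosed C ∧ LConvex C ∧ X ⊆ C}

theorem hull_closed (X : Set (Ω →ₘ[P] B)) : SeqClosed (hull X) := sInter_closed fun _ h => h.1
theorem hull_conv (X : Set (Ω →ₘ[P] B)) : LConvex (hull X) := sInter_conv fun _ h => h.2.1
theorem subset_hull (X : Set (Ω →ₘ[P] B)) : X ⊆ hull X := fun _ hx _ hC => hC.2.2 hx
theorem hull_subset {X C : Set (Ω →ₘ[P] B)} (h1 : SeqClosed C) (h2 : LConvex C) (h : X ⊆ C) :
    hull X ⊆ C := fun _ hx => hx C ⟨h1, h2, h⟩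

/-! gluing -/
theorem glue {K : Set (Ω →ₘ[P] B)} (hK : LConvex K) {x y : Ω →ₘ[P] B} (hx : x ∈ K) (hy : y ∈ K)
    {A : Set Ω} (hA : MeasurableSet A) :
    ∃ z ∈ K, ∀ᵐ ω ∂P, (ω ∈ A → z ω = x ω) ∧ (ω ∉ A → z ω = y ω) := by
  have hi : ∀ᵐ ω ∂P, (ind A hA : Ω →ₘ[P] ℝ) ω = A.indicator (fun _ => (1 : ℝ)) ω :=
    AEEqFun.coeFn_mk _ _
  refine ⟨_, hK x hx y hy (ind A hA) ?_ ?_, ?_⟩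
  · rw [le_iff_ae]
    filter_upwards [hi, AEEqFun.coeFn_zero (α := Ω) (β := ℝ) (μ := P)] with ω h1 h2
    rw [h1, h2]
    exact indicator_nonneg (fun _ _ => zero_le_one) _
  · rw [le_iff_ae]
    filter_upwards [hi, AEEqFun.coeFn_one (α := Ω) (β := ℝ) (μ := P)] with ω h1 h2
    rw [h1, h2]
    exact indicator_le_self' (fun _ _ => zero_le_one) _
  · filter_upwards [hi, comb_ae (ind A hA) x y] with ω h1 h2
    rw [h2, h1]
    constructor
    · intro h
      simp [h]
    · intro h
      simp [h]

/-- images of glueable sets are upward directed -/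
theorem measSet (f g : Ω →ₘ[P] ℝ) : ∃ A : Set Ω, MeasurableSet A ∧
    ∀ᵐ ω ∂P, (ω ∈ A ↔ f ω ≤ g ω) := 
  ⟨{ω | f ω ≤ g ω}, measurableSet_le f.measurable g.measurable, by simp⟩

/-! closure -/
theorem mem_cl_iff [IsProbabilityMeasure P] {S : Set (Ω →ₘ[P] B)} {y : Ω →ₘ[P] B} :
    y ∈ seqClosure S ↔
    ∀ ε : ℝ, 0 < ε → ∃ x ∈ S, P {ω | ε ≤ ‖x ω - y ω‖} ≤ ENNReal.ofReal ε := by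
  constructor
  · rintro ⟨x, hx, h⟩ ε hε
    rw [tendstoInMeasure_iff_norm] at h
    have := (h ε hε).eventually (ge_mem_nhds (ENNReal.ofReal_pos.2 hε))
    obtain ⟨n, hn⟩ := this.exists
    exact ⟨x n, hx n, hn⟩
  · intro h
    have : ∀ n : ℕ, ∃ x ∈ S, P {ω | (1 / ((n : ℝ) + 1)) ≤ ‖x ω - y ω‖} ≤
        ENNReal.ofReal (1 / ((n : ℝ) + 1)) := fun n => h _ (by positivity)
    choose x hx hxP using this
    refine ⟨x, hx, ?_⟩
    rw [tendstoInMeasure_iff_norm]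
    intro ε hε
    have hlim : Tendsto (fun n : ℕ => ENNReal.ofReal (1 / ((n : ℝ) + 1))) atTop (𝓝 0) := by
      have := ENNReal.tendsto_ofReal (tendsto_one_div_add_atTop_nhds_zero_nat (𝕜 := ℝ))
      simpa using this
    refine tendsto_of_tendsto_of_tendsto_of_le_of_le' tendsto_const_nhds hlim
      (Eventually.of_forall fun _ => zero_le) ?_
    have := (tendsto_one_div_add_atTop_nhds_zero_nat (𝕜 := ℝ)).eventually (ge_mem_nhds hε)
    filter_upwards [this] with n hn
    exact (measure_mono fun ω hω => le_trans hn hω).trans (hxP n)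

theorem sub_cl [IsProbabilityMeasure P] (S : Set (Ω →ₘ[P] B)) : S ⊆ seqClosure S := by
  intro x hx
  rw [mem_cl_iff]
  intro ε hε
  refine ⟨x, hx, ?_⟩
  have : {ω | ε ≤ ‖x ω - x ω‖} = ∅ := by
    ext ω
    simp [hε]
  rw [this]
  simp

theorem cl_sub {S C : Set (Ω →ₘ[P] B)} (hC : SeqClosed C) (h : S ⊆ C) : seqClosure S ⊆ C := by
  rintro y ⟨x, hx, hy⟩
  exact hC x y (fun n => h (hx n)) hy

/-- key approximation transfer -/
theorem cl_transfer2 [IsProbabilityMeasure P] {S S' U : Set (Ω →ₘ[P] B)} {y y' v : Ω →ₘ[P] B}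
    (hy : y ∈ seqClosure S) (hy' : y' ∈ seqClosure S')
    (h : ∀ x ∈ S, ∀ x' ∈ S', ∃ u ∈ U, ∀ᵐ ω ∂P, ‖u ω - v ω‖ ≤ ‖x ω - y ω‖ + ‖x' ω - y' ω‖) :
    v ∈ seqClosure U := by
  rw [mem_cl_iff] at hy hy' ⊢
  intro ε hε
  obtain ⟨x, hx, hxP⟩ := hy (ε / 2) (by positivity)
  obtain ⟨x', hx', hxP'⟩ := hy' (ε / 2) (by positivity)
  obtain ⟨u, hu, huv⟩ := h x hx x' hx'
  refine ⟨u, hu, ?_⟩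
  calc P {ω | ε ≤ ‖u ω - v ω‖} ≤ P ({ω | ε / 2 ≤ ‖x ω - y ω‖} ∪ {ω | ε / 2 ≤ ‖x' ω - y' ω‖}) := by
        apply measure_mono_ae
        filter_upwards [huv] with ω h1 (h2 : ε ≤ _)
        change _ ∨ _
        by_contra hc
        push Not at hc
        obtain ⟨hc1, hc2⟩ := hc
        change ¬ (ε / 2 ≤ ‖x ω - y ω‖) at hc1
        change ¬ (ε / 2 ≤ ‖x' ω - y' ω‖) at hc2
        linarith
    _ ≤ _ := measure_union_le _ _
    _ ≤ ENNReal.ofReal (ε / 2) + ENNReal.ofReal (ε / 2) := add_le_add hxP hxP'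
    _ = ENNReal.ofReal ε := by
      rw [← ENNReal.ofReal_add (by positivity) (by positivity), add_halves]

theorem cl_transfer [IsProbabilityMeasure P] {S U : Set (Ω →ₘ[P] B)} {y v : Ω →ₘ[P] B}
    (hy : y ∈ seqClosure S)
    (h : ∀ x ∈ S, ∃ u ∈ U, ∀ᵐ ω ∂P, ‖u ω - v ω‖ ≤ ‖x ω - y ω‖) :
    v ∈ seqClosure U := by
  refine cl_transfer2 hy (sub_cl {y} rfl) ?_
  intro x hx x' hx'
  obtain ⟨u, hu, h2⟩ := h x hx
  refine ⟨u, hu, ?_⟩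
  filter_upwards [h2] with ω h3
  have := norm_nonneg (x' ω - y ω)
  linarith

theorem cl_closed [IsProbabilityMeasure P] (S : Set (Ω →ₘ[P] B)) : SeqClosed (seqClosure S) := by
  intro x y hx hy
  have hy2 : y ∈ seqClosure (seqClosure S) := ⟨x, hx, hy⟩
  rw [mem_cl_iff] at hy2 ⊢
  intro ε hε
  obtain ⟨z, hz, hzP⟩ := hy2 (ε / 2) (by positivity)
  obtain ⟨u, hu, huP⟩ := mem_cl_iff.1 hz (ε / 2) (by positivity)
  refine ⟨u, hu, ?_⟩
  calc P {ω | ε ≤ ‖u ω - y ω‖} ≤ P ({ω | ε / 2 ≤ ‖u ω - z ω‖} ∪ {ω | ε / 2 ≤ ‖z ω - y ω‖}) := by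
        apply measure_mono
        intro ω (h2 : ε ≤ _)
        by_contra hc
        simp only [mem_union, mem_ofPred_eq, not_or, not_le] at hc
        have := norm_sub_le_norm_sub_add_norm_sub (u ω) (z ω) (y ω)
        linarith
    _ ≤ _ := measure_union_le _ _
    _ ≤ ENNReal.ofReal (ε / 2) + ENNReal.ofReal (ε / 2) := add_le_add huP hzP
    _ = ENNReal.ofReal ε := by
      rw [← ENNReal.ofReal_add (by positivity) (by positivity), add_halves]

theorem cl_conv [IsProbabilityMeasure P] {S : Set (Ω →ₘ[P] B)} (hS : LConvex S) :
    LConvex (seqClosure S) := by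
  intro x hx y hy l h0 h1
  refine cl_transfer2 hx hy ?_
  intro x' hx' y' hy'
  refine ⟨_, hS x' hx' y' hy' l h0 h1, ?_⟩
  filter_upwards [comb_ae l x y, comb_ae l x' y', l01 h0 h1] with ω h2 h3 h4
  rw [h2, h3]
  have : l ω • x' ω + (1 - l ω) • y' ω - (l ω • x ω + (1 - l ω) • y ω) =
    l ω • (x' ω - x ω) + (1 - l ω) • (y' ω - y ω) := by module
  rw [this]
  calc _ ≤ ‖l ω • (x' ω - x ω)‖ + ‖(1 - l ω) • (y' ω - y ω)‖ := norm_add_le _ _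
    _ = l ω * ‖x' ω - x ω‖ + (1 - l ω) * ‖y' ω - y ω‖ := by
      rw [norm_smul, norm_smul, Real.norm_of_nonneg h4.1, Real.norm_of_nonneg (by linarith [h4.2])]
    _ ≤ 1 * ‖x' ω - x ω‖ + 1 * ‖y' ω - y ω‖ := by
      have := h4.1
      have := h4.2
      gcongr
      linarith
    _ = _ := by ring


/-! directed families in `L⁰` -/

def Dir (S : Set (Ω →ₘ[P] ℝ)) : Prop := ∀ a ∈ S, ∀ b ∈ S, ∃ c ∈ S, a ≤ c ∧ b ≤ c

theorem atan_int [IsProbabilityMeasure P] (f : Ω →ₘ[P] ℝ) :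
    Integrable (fun ω => Real.arctan (f ω)) P := by
  refine Integrable.of_bound (C := Real.pi / 2) ?_ ?_
  · exact Real.continuous_arctan.comp_aestronglyMeasurable f.aestronglyMeasurable
  · filter_upwards with ω
    rw [Real.norm_eq_abs, abs_le]
    exact ⟨(Real.neg_pi_div_two_lt_arctan _).le, (Real.arctan_lt_pi_div_two _).le⟩

theorem seq_dir [IsProbabilityMeasure P] {S : Set (Ω →ₘ[P] ℝ)} (hne : S.Nonempty) (hd : Dir S) :
    ∃ a : ℕ → Ω →ₘ[P] ℝ, (∀ n, a n ∈ S) ∧ Monotone a ∧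
      ∀ b ∈ S, ∀ᵐ ω ∂P, ∀ c : ℝ, (∀ n, a n ω ≤ c) → b ω ≤ c := by
  set J : (Ω →ₘ[P] ℝ) → ℝ := fun f => ∫ ω, Real.arctan (f ω) ∂P with hJ
  have hJb : BddAbove (J '' S) := by
    refine ⟨Real.pi / 2, ?_⟩
    rintro _ ⟨f, -, rfl⟩
    calc J f ≤ ∫ ω, Real.pi / 2 ∂P := integral_mono (atan_int f) (integrable_const _)
          fun ω => (Real.arctan_lt_pi_div_two _).le
      _ = Real.pi / 2 := by simp
  have hex : ∀ n : ℕ, ∃ b ∈ S, sSup (J '' S) - 1 / ((n : ℝ) + 1) < J b := by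
    intro n
    have : sSup (J '' S) - 1 / ((n : ℝ) + 1) < sSup (J '' S) := by
      have : 0 < 1 / ((n : ℝ) + 1) := by positivity
      linarith
    obtain ⟨_, ⟨b, hb, rfl⟩, h⟩ := exists_lt_of_lt_csSup (hne.image J) this
    exact ⟨b, hb, h⟩
  choose b hbS hb using hex
  choose! u huS hu1 hu2 using hd
  let a : ℕ → Ω →ₘ[P] ℝ := fun n => Nat.rec (b 0) (fun k x => u x (b (k + 1))) n
  have haS : ∀ n, a n ∈ S := by
    intro n
    induction n with
    | zero => exact hbS 0
    | succ k ih => exact huS _ ih _ (hbS _)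
  have hmono : Monotone a := monotone_nat_of_le_succ fun n => hu1 _ (haS n) _ (hbS _)
  have hab : ∀ n, b n ≤ a n := by
    intro n
    cases n with
    | zero => exact le_rfl
    | succ k => exact hu2 _ (haS k) _ (hbS _)
  have hJmono : ∀ f g : Ω →ₘ[P] ℝ, f ≤ g → J f ≤ J g := by
    intro f g h
    refine integral_mono_ae (atan_int f) (atan_int g) ?_
    filter_upwards [(le_iff_ae _ _).1 h] with ω h1
    exact Real.arctan_mono h1
  refine ⟨a, haS, hmono, ?_⟩
  intro y hy
  set g : ℕ → Ω → ℝ := fun n ω => max (Real.arctan (y ω) - Real.arctan (a n ω)) 0 with hg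
  have hgi : ∀ n, Integrable (g n) P := fun n => ((atan_int y).sub (atan_int (a n))).pos_part
  have hgb : ∀ n : ℕ, ∫ ω, g n ω ∂P ≤ 1 / ((n : ℝ) + 1) := by
    intro n
    have h1 : ∫ ω, g n ω ∂P ≤
        ∫ ω, (Real.arctan (u (a n) y ω) - Real.arctan (a n ω)) ∂P := by
      refine integral_mono_ae (hgi n) ((atan_int _).sub (atan_int _)) ?_
      filter_upwards [(le_iff_ae _ _).1 (hu1 _ (haS n) _ hy), (le_iff_ae _ _).1 (hu2 _ (haS n) _ hy)]
        with ω h1 h2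
      have := Real.arctan_mono h1
      have := Real.arctan_mono h2
      apply max_le <;> linarith
    rw [integral_sub (atan_int _) (atan_int _)] at h1
    have h2 : J (u (a n) y) ≤ sSup (J '' S) := le_csSup hJb ⟨_, huS _ (haS n) _ hy, rfl⟩
    have h3 := hb n
    have h4 := hJmono _ _ (hab n)
    simp only [hJ] at h2 h3 h4 h1 ⊢
    linarith
  have hF : ∫⁻ ω, ⨅ n, ENNReal.ofReal (g n ω) ∂P = 0 := by
    have h1 : ∀ n : ℕ, ∫⁻ ω, ⨅ n, ENNReal.ofReal (g n ω) ∂P ≤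
        ENNReal.ofReal (1 / ((n : ℝ) + 1)) := by
      intro n
      calc _ ≤ ∫⁻ ω, ENNReal.ofReal (g n ω) ∂P := lintegral_mono fun ω => iInf_le _ n
        _ = ENNReal.ofReal (∫ ω, g n ω ∂P) :=
          (ofReal_integral_eq_lintegral_ofReal (hgi n)
            (Eventually.of_forall fun ω => le_max_right _ _)).symm
        _ ≤ _ := ENNReal.ofReal_le_ofReal (hgb n)
    have hlim : Tendsto (fun n : ℕ => ENNReal.ofReal (1 / ((n : ℝ) + 1))) atTop (𝓝 0) := by
      have := ENNReal.tendsto_ofReal (tendsto_one_div_add_atTop_nhds_zero_nat (𝕜 := ℝ))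
      simpa using this
    exact le_antisymm (ge_of_tendsto' hlim h1) zero_le
  rw [lintegral_eq_zero_iff' (AEMeasurable.iInf fun n => (hgi n).aemeasurable.ennreal_ofReal)] at hF
  filter_upwards [hF] with ω hω c hc
  by_contra hcon
  push Not at hcon
  have h1 : ENNReal.ofReal (Real.arctan (y ω) - Real.arctan c) ≤ ⨅ n, ENNReal.ofReal (g n ω) := by
    refine le_iInf fun n => ENNReal.ofReal_le_ofReal ?_
    have := Real.arctan_mono (hc n)
    exact le_trans (by linarith) (le_max_left _ _)
  rw [hω] at h1
  have h2 := Real.arctan_strictMono hcon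
  have h3 : 0 < ENNReal.ofReal (Real.arctan (y ω) - Real.arctan c) :=
    ENNReal.ofReal_pos.2 (by linarith)
  exact absurd h1 (not_le.2 h3)

theorem lub_of_seq {S : Set (Ω →ₘ[P] ℝ)} {a : ℕ → Ω →ₘ[P] ℝ} (ha : ∀ n, a n ∈ S)
    (hm : Monotone a) (hs : ∀ b ∈ S, ∀ᵐ ω ∂P, ∀ c : ℝ, (∀ n, a n ω ≤ c) → b ω ≤ c)
    (hb : ∀ᵐ ω ∂P, BddAbove (range fun n => a n ω)) :
    ∃ ξ, IsLUB S ξ ∧ ∀ᵐ ω ∂P, Tendsto (fun n => a n ω) atTop (𝓝 (ξ ω)) := by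
  have hmeas : Measurable fun ω => ⨆ n, a n ω := Measurable.iSup fun n => (a n).measurable
  set ξ : Ω →ₘ[P] ℝ := AEEqFun.mk (fun ω => ⨆ n, a n ω) hmeas.aestronglyMeasurable with hξ
  have hξae : ∀ᵐ ω ∂P, ξ ω = ⨆ n, a n ω := AEEqFun.coeFn_mk _ _
  have hmono : ∀ᵐ ω ∂P, Monotone fun n => a n ω := by
    have : ∀ᵐ ω ∂P, ∀ n, a n ω ≤ a (n + 1) ω :=
      ae_all_iff.2 fun n => (le_iff_ae _ _).1 (hm (Nat.le_succ n))
    filter_upwards [this] with ω h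
    exact monotone_nat_of_le_succ h
  refine ⟨ξ, ⟨?_, ?_⟩, ?_⟩
  · intro b hbS
    rw [le_iff_ae]
    filter_upwards [hs b hbS, hξae, hb] with ω h1 h2 h3
    rw [h2]
    exact h1 _ fun n => le_ciSup h3 n
  · intro c hc
    rw [le_iff_ae]
    have : ∀ᵐ ω ∂P, ∀ n, a n ω ≤ c ω := ae_all_iff.2 fun n => (le_iff_ae _ _).1 (hc (ha n))
    filter_upwards [this, hξae] with ω h1 h2
    rw [h2]
    exact ciSup_le h1
  · filter_upwards [hmono, hb, hξae] with ω h1 h2 h3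
    rw [h3]
    exact tendsto_atTop_ciSup h1 h2

theorem lub_dir [IsProbabilityMeasure P] {S : Set (Ω →ₘ[P] ℝ)} (hne : S.Nonempty) (hd : Dir S)
    (hb : BddAbove S) :
    ∃ ξ, IsLUB S ξ ∧ ∃ a : ℕ → Ω →ₘ[P] ℝ, (∀ n, a n ∈ S) ∧
      ∀ᵐ ω ∂P, Tendsto (fun n => a n ω) atTop (𝓝 (ξ ω)) := by
  obtain ⟨a, ha, hm, hs⟩ := seq_dir hne hd
  obtain ⟨c, hc⟩ := hb
  obtain ⟨ξ, h1, h2⟩ := lub_of_seq ha hm hs (by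
    have : ∀ᵐ ω ∂P, ∀ n, a n ω ≤ c ω := ae_all_iff.2 fun n => (le_iff_ae _ _).1 (hc (ha n))
    filter_upwards [this] with ω h
    exact ⟨c ω, by rintro _ ⟨n, rfl⟩; exact h n⟩)
  exact ⟨ξ, h1, a, ha, h2⟩

theorem approx_dir [IsProbabilityMeasure P] {S : Set (Ω →ₘ[P] ℝ)} (hne : S.Nonempty) (hd : Dir S)
    (hb : BddAbove S) (ρ : Ω →ₘ[P] ℝ) (hρ : ∀ c ∈ upperBounds S, ρ ≤ c) (ε : ℝ) (hε : 0 < ε) :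
    ∃ a ∈ S, P {ω | a ω + ε ≤ ρ ω} ≤ ENNReal.ofReal ε := by
  obtain ⟨ξ, h1, a, ha, hlim⟩ := lub_dir hne hd hb
  have h2 := tendstoInMeasure_of_tendsto_ae (fun n => (a n).aestronglyMeasurable) hlim
  rw [tendstoInMeasure_iff_norm] at h2
  obtain ⟨n, hn⟩ := ((h2 ε hε).eventually (ge_mem_nhds (ENNReal.ofReal_pos.2 hε))).exists
  refine ⟨a n, ha n, le_trans (measure_mono_ae ?_) hn⟩
  filter_upwards [(le_iff_ae _ _).1 (hρ ξ h1.1)] with ω h3 (h4 : _ ≤ _)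
  change ε ≤ ‖a n ω - ξ ω‖
  rw [Real.norm_eq_abs, abs_sub_comm]
  exact le_trans (by linarith) (le_abs_self _)

theorem lsup_isLUB {S : Set (Ω →ₘ[P] ℝ)} (h : ∃ ξ, IsLUB S ξ) : IsLUB S (lsup S) := by
  unfold lsup
  rw [dif_pos h]
  exact h.choose_spec

theorem linf_isGLB {S : Set (Ω →ₘ[P] ℝ)} (h : ∃ ξ, IsGLB S ξ) : IsGLB S (linf S) := by
  unfold linf
  rw [dif_pos h]
  exact h.choose_spec

/-- The distances from a point to an L⁰-convex set are directed. -/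
theorem dir_dist {K : Set (Ω →ₘ[P] B)} (hK : LConvex K) (x : Ω →ₘ[P] B) :
    Dir ((fun y => nrm (x - y)) '' K) := by
  rintro _ ⟨y, hy, rfl⟩ _ ⟨y', hy', rfl⟩
  obtain ⟨A, hA, hA2⟩ := measSet (nrm (x - y)) (nrm (x - y'))
  obtain ⟨z, hz, hzz⟩ := glue hK hy' hy hA
  refine ⟨_, ⟨z, hz, rfl⟩, (nsub_le_iff _ _ _).2 ?_, (nsub_le_iff _ _ _).2 ?_⟩ <;>
  · filter_upwards [hA2, hzz, nsub_ae x y, nsub_ae x y', nsub_ae x z] with ω h1 h2 h3 h4 h5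
    rw [h5]
    rw [h3, h4] at h1
    by_cases h : ω ∈ A
    · have := h1.1 h
      rw [h2.1 h] <;> linarith
    · have := mt h1.2 h
      rw [h2.2 h] <;> linarith

theorem dir_diam {K : Set (Ω →ₘ[P] B)} (hK : LConvex K) :
    Dir {ξ : Ω →ₘ[P] ℝ | ∃ x ∈ K, ∃ y ∈ K, ξ = nrm (x - y)} := by
  rintro _ ⟨x, hx, y, hy, rfl⟩ _ ⟨x', hx', y', hy', rfl⟩
  obtain ⟨A, hA, hA2⟩ := measSet (nrm (x - y)) (nrm (x' - y'))
  obtain ⟨z, hz, hzz⟩ := glue hK hy' hy hA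
  obtain ⟨w, hw, hww⟩ := glue hK hx' hx hA
  refine ⟨_, ⟨w, hw, z, hz, rfl⟩, (nsub_le_iff _ _ _).2 ?_, (nsub_le_iff _ _ _).2 ?_⟩ <;>
  · filter_upwards [hA2, hzz, hww, nsub_ae x y, nsub_ae x' y', nsub_ae w z] with ω h1 h2 h6 h3 h4 h5
    rw [h5]
    rw [h3, h4] at h1
    by_cases h : ω ∈ A
    · have := h1.1 h
      rw [h2.1 h, h6.1 h] <;> linarith
    · have := mt h1.2 h
      rw [h2.2 h, h6.2 h] <;> linarith

theorem nrm_le_iff (x : Ω →ₘ[P] B) (c : Ω →ₘ[P] ℝ) :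
    nrm x ≤ c ↔ ∀ᵐ ω ∂P, ‖x ω‖ ≤ c ω := by
  rw [le_iff_ae]
  constructor
  · intro h
    filter_upwards [h, nrm_ae x] with ω h1 h2
    rwa [← h2]
  · intro h
    filter_upwards [h, nrm_ae x] with ω h1 h2
    rwa [h2]

theorem nsub_le_of_bdd {ξ : Ω →ₘ[P] ℝ} {x y : Ω →ₘ[P] B} (hx : nrm x ≤ ξ) (hy : nrm y ≤ ξ) :
    nrm (x - y) ≤ ξ + ξ := by
  rw [nsub_le_iff]
  filter_upwards [(nrm_le_iff _ _).1 hx, (nrm_le_iff _ _).1 hy, AEEqFun.coeFn_add ξ ξ]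
    with ω h1 h2 h3
  rw [h3]
  exact (norm_sub_le _ _).trans (add_le_add h1 h2)

theorem Rr_lub [IsProbabilityMeasure P] {K : Set (Ω →ₘ[P] B)} (hne : K.Nonempty) (hK : LConvex K)
    (hb : ASBounded K) {x : Ω →ₘ[P] B} (hx : x ∈ K) :
    IsLUB ((fun y => nrm (x - y)) '' K) (Rr K x) := by
  obtain ⟨ξ, hξ⟩ := hb
  obtain ⟨η, h, -⟩ := lub_dir (hne.image (fun y => nrm (x - y))) (dir_dist hK x) (by
    refine ⟨ξ + ξ, ?_⟩
    rintro _ ⟨y, hy, rfl⟩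
    exact nsub_le_of_bdd (hξ x hx) (hξ y hy))
  exact lsup_isLUB ⟨η, h⟩

theorem Dd_lub [IsProbabilityMeasure P] {K : Set (Ω →ₘ[P] B)} (hne : K.Nonempty) (hK : LConvex K)
    (hb : ASBounded K) :
    IsLUB {ξ : Ω →ₘ[P] ℝ | ∃ x ∈ K, ∃ y ∈ K, ξ = nrm (x - y)} (Dd K) := by
  obtain ⟨ξ, hξ⟩ := hb
  obtain ⟨x0, hx0⟩ := hne
  obtain ⟨η, h, -⟩ := lub_dir (S := {ξ : Ω →ₘ[P] ℝ | ∃ x ∈ K, ∃ y ∈ K, ξ = nrm (x - y)})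
    ⟨_, x0, hx0, x0, hx0, rfl⟩ (dir_diam hK) (by
    refine ⟨ξ + ξ, ?_⟩
    rintro _ ⟨x, hx, y, hy, rfl⟩
    exact nsub_le_of_bdd (hξ x hx) (hξ y hy))
  exact lsup_isLUB ⟨η, h⟩


/-! consequences of convex compactness -/

theorem fip_dir {α : Type*} [Nonempty α] {F : Set (Set α)} (hne : ∀ C ∈ F, C.Nonempty)
    (hd : ∀ C ∈ F, ∀ D ∈ F, ∃ E ∈ F, E ⊆ C ∧ E ⊆ D) (S : Finset (Set α)) (hS : ↑S ⊆ F) :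
    (⋂₀ (S : Set (Set α))).Nonempty := by
  by_cases hF : F.Nonempty
  · obtain ⟨D, hD, hDs⟩ : ∃ D ∈ F, ∀ C ∈ S, D ⊆ C := by
      induction S using Finset.induction_on with
      | empty => exact ⟨_, hF.choose_spec, by simp⟩
      | insert C S _ ih =>
        obtain ⟨D, hD, h⟩ := ih (fun x hx => hS (by simp at hx ⊢; exact Or.inr hx))
        obtain ⟨E, hE, h1, h2⟩ := hd C (hS (by simp)) D hD
        refine ⟨E, hE, ?_⟩
        intro C' hC'
        rcases Finset.mem_insert.1 hC' with rfl | h'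
        · exact h1
        · exact h2.trans (h _ h')
    obtain ⟨x, hx⟩ := hne D hD
    exact ⟨x, fun C hC => hDs C hC hx⟩
  · have : S = ∅ := by
      rw [Finset.eq_empty_iff_forall_notMem]
      exact fun C hC => hF ⟨C, hS hC⟩
    subst this
    simp

theorem compact_dir {G : Set (Ω →ₘ[P] B)} (hG : ConvexlyCompact G) {F : Set (Set (Ω →ₘ[P] B))}
    (h : ∀ C ∈ F, C.Nonempty ∧ C ⊆ G ∧ SeqClosed C ∧ LConvex C)
    (hd : ∀ C ∈ F, ∀ D ∈ F, ∃ E ∈ F, E ⊆ C ∧ E ⊆ D) : (⋂₀ F).Nonempty :=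
  hG.2.2.2 F h (fip_dir (fun C hC => (h C hC).1) hd)

theorem min_exists {G : Set (Ω →ₘ[P] B)} (hG : ConvexlyCompact G) {K : Set (Ω →ₘ[P] B)}
    (hKG : K ⊆ G) (hne : K.Nonempty) (f : (Ω →ₘ[P] B) → (Ω →ₘ[P] ℝ))
    (hcl : ∀ y ∈ K, SeqClosed {x ∈ K | f x ≤ f y}) (hcv : ∀ y ∈ K, LConvex {x ∈ K | f x ≤ f y})
    (hd : ∀ x ∈ K, ∀ y ∈ K, ∃ z ∈ K, f z ≤ f x ∧ f z ≤ f y) :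
    ∃ x ∈ K, ∀ y ∈ K, f x ≤ f y := by
  obtain ⟨x, hx⟩ := compact_dir hG (F := {C | ∃ y ∈ K, C = {x ∈ K | f x ≤ f y}}) (by
      rintro _ ⟨y, hy, rfl⟩
      exact ⟨⟨y, hy, le_rfl⟩, fun x hx => hKG hx.1, hcl y hy, hcv y hy⟩) (by
      rintro _ ⟨y, hy, rfl⟩ _ ⟨y', hy', rfl⟩
      obtain ⟨z, hz, h1, h2⟩ := hd y hy y' hy'
      exact ⟨_, ⟨z, hz, rfl⟩, fun x hx => ⟨hx.1, hx.2.trans h1⟩,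
        fun x hx => ⟨hx.1, hx.2.trans h2⟩⟩)
  obtain ⟨y0, hy0⟩ := hne
  exact ⟨x, (hx _ ⟨y0, hy0, rfl⟩).1, fun y hy => (hx _ ⟨y, hy, rfl⟩).2⟩

/-! boundedness -/

theorem functional_min {G : Set (Ω →ₘ[P] B)} (hG : ConvexlyCompact G)
    (f : Ω → (B →L[ℝ] ℝ)) (hf : StronglyMeasurable f) :
    ∃ x ∈ G, ∀ y ∈ G, ∀ᵐ ω ∂P, f ω (x ω) ≤ f ω (y ω) := by
  have hm : ∀ x : Ω →ₘ[P] B, AEStronglyMeasurable (fun ω => f ω (x ω)) P := fun x =>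
    isBoundedBilinearMap_apply.continuous.comp_aestronglyMeasurable
      (hf.aestronglyMeasurable.prodMk x.aestronglyMeasurable)
  let φ : (Ω →ₘ[P] B) → (Ω →ₘ[P] ℝ) := fun x => AEEqFun.mk _ (hm x)
  have hφ : ∀ x, ∀ᵐ ω ∂P, φ x ω = f ω (x ω) := fun x => AEEqFun.coeFn_mk _ _
  have hle : ∀ x y, φ x ≤ φ y ↔ ∀ᵐ ω ∂P, f ω (x ω) ≤ f ω (y ω) := by
    intro x y
    rw [le_iff_ae]
    constructor <;> intro h
    · filter_upwards [h, hφ x, hφ y] with ω h1 h2 h3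
      rwa [← h2, ← h3]
    · filter_upwards [h, hφ x, hφ y] with ω h1 h2 h3
      rwa [h2, h3]
  refine (min_exists hG (le_refl G) hG.1 φ ?_ ?_ ?_).imp fun x h =>
    ⟨h.1, fun y hy => (hle _ _).1 (h.2 y hy)⟩
  · intro y hy x z hx hz
    refine ⟨hG.2.1 x z (fun n => (hx n).1) hz, (hle _ _).2 ?_⟩
    obtain ⟨ns, -, hns⟩ := hz.exists_seq_tendsto_ae
    have h1 : ∀ᵐ ω ∂P, ∀ n, f ω (x n ω) ≤ f ω (y ω) :=
      ae_all_iff.2 fun n => (hle _ _).1 (hx n).2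
    filter_upwards [h1, hns] with ω h2 h3
    exact le_of_tendsto (((f ω).continuous.tendsto _).comp h3) (Eventually.of_forall fun n => h2 _)
  · intro y hy x hx z hz l h0 h1
    refine ⟨hG.2.2.1 x hx.1 z hz.1 l h0 h1, (hle _ _).2 ?_⟩
    filter_upwards [(hle _ _).1 hx.2, (hle _ _).1 hz.2, comb_ae l x z, l01 h0 h1]
      with ω h2 h3 h4 h5
    rw [h4, map_add, map_smul, map_smul, smul_eq_mul, smul_eq_mul]
    have := h5.1
    have : 0 ≤ 1 - l ω := by linarith [h5.2]
    calc _ ≤ l ω * f ω (y ω) + (1 - l ω) * f ω (y ω) := by gcongr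
      _ = _ := by ring
  · intro x hx y hy
    obtain ⟨A, hA, hA2⟩ := measSet (φ x) (φ y)
    obtain ⟨z, hz, hzz⟩ := glue hG.2.2.1 hx hy hA
    refine ⟨z, hz, (hle _ _).2 ?_, (hle _ _).2 ?_⟩ <;>
    · filter_upwards [hA2, hzz, hφ x, hφ y] with ω h1 h2 h3 h4
      rw [h3, h4] at h1
      by_cases h : ω ∈ A
      · have := h1.1 h
        rw [h2.1 h] <;> linarith
      · have := mt h1.2 h
        rw [h2.2 h] <;> linarith

theorem norming (x : Ω →ₘ[P] B) : ∃ f : Ω → (B →L[ℝ] ℝ), StronglyMeasurable f ∧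
    (∀ ω, ‖f ω‖ ≤ 1) ∧ ∀ ω, 3 / 4 * ‖x ω‖ ≤ f ω (x ω) := by
  obtain ⟨c, hc, hcx⟩ := x.stronglyMeasurable.isSeparable_range
  obtain ⟨d, hd⟩ := (hc.insert 0).exists_eq_range (insert_nonempty _ _)
  have hex : ∀ ω, ∃ k, ‖x ω - d k‖ ≤ ‖x ω‖ / 8 := by
    intro ω
    by_cases h : x ω = 0
    · have : (0 : B) ∈ range d := hd ▸ mem_insert _ _
      obtain ⟨k, hk⟩ := this
      exact ⟨k, by simp [hk, h]⟩
    · have h1 : x ω ∈ closure c := hcx (mem_range_self ω)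
      obtain ⟨b, hb, hb2⟩ := Metric.mem_closure_iff.1 h1 (‖x ω‖ / 8)
        (by have := norm_pos_iff.2 h; positivity)
      have : b ∈ range d := hd ▸ mem_insert_of_mem _ hb
      obtain ⟨k, rfl⟩ := this
      exact ⟨k, by rw [← dist_eq_norm]; exact hb2.le⟩
  have hg : ∀ k, ∃ g : B →L[ℝ] ℝ, ‖g‖ ≤ 1 ∧ g (d k) = ‖d k‖ := fun k => by
    simpa using exists_dual_vector'' ℝ (d k)
  choose g hg1 hg2 using hg
  have hk : Measurable fun ω => Nat.find (hex ω) := by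
    refine measurable_find hex fun k => ?_
    exact measurableSet_le ((x.stronglyMeasurable.sub stronglyMeasurable_const).norm.measurable)
      (x.stronglyMeasurable.norm.measurable.div_const _)
  refine ⟨fun ω => g (Nat.find (hex ω)), ?_, fun ω => hg1 _, ?_⟩
  · exact (StronglyMeasurable.of_discrete (f := g)).comp_measurable hk
  · intro ω
    have h := Nat.find_spec (hex ω)
    set k := Nat.find (hex ω)
    have h1 : g k (x ω) = ‖d k‖ + g k (x ω - d k) := by rw [map_sub, hg2]; ring
    have h2 : |g k (x ω - d k)| ≤ ‖x ω - d k‖ := by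
      have := (g k).le_opNorm (x ω - d k)
      rw [Real.norm_eq_abs] at this
      have h3 := hg1 k
      have h4 := norm_nonneg (x ω - d k)
      nlinarith
    have h3 := abs_le.1 h2
    have h4 : ‖x ω‖ ≤ ‖x ω - d k‖ + ‖d k‖ := by
      simpa using norm_add_le (x ω - d k) (d k)
    change _ ≤ g k (x ω)
    linarith

theorem unbdd_spread [IsProbabilityMeasure P] {G : Set (Ω →ₘ[P] B)} (hne : G.Nonempty)
    (hG : LConvex G) (hb : ¬ ASBounded G) :
    ∃ δ : ℝ≥0∞, 0 < δ ∧ ∀ c : ℝ, ∃ x ∈ G, δ ≤ P {ω | c ≤ ‖x ω‖} := by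
  by_contra hcon
  push Not at hcon
  apply hb
  have hS : ((fun y : Ω →ₘ[P] B => nrm (0 - y)) '' G).Nonempty := hne.image _
  obtain ⟨a, ha, hm, hs⟩ := seq_dir hS (dir_dist hG 0)
  have hn0 : ∀ y : Ω →ₘ[P] B, nrm (0 - y) = nrm y := by
    intro y
    rw [nsub_comm, sub_zero]
  have hN : P {ω | ¬ BddAbove (range fun n => a n ω)} = 0 := by
    by_contra h0
    obtain ⟨c, hc⟩ := hcon _ (ENNReal.half_pos h0)
    have h1 : {ω | ¬ BddAbove (range fun n => a n ω)} ⊆ ⋃ n, {ω | c ≤ a n ω} := by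
      intro ω hω
      by_contra h
      apply hω
      refine ⟨c, ?_⟩
      rintro _ ⟨n, rfl⟩
      simp only [mem_iUnion, mem_ofPred_eq, not_exists, not_le] at h
      exact (h n).le
    have h2 : P (⋃ n, {ω | c ≤ a n ω}) ≤ P {ω | ¬ BddAbove (range fun n => a n ω)} / 2 := by
      rw [measure_iUnion_eq_iSup_accumulate]
      refine iSup_le fun n => ?_
      obtain ⟨y, hy, hya⟩ := ha n
      refine le_trans (measure_mono_ae ?_) (hc y hy).le
      have hmn : ∀ᵐ ω ∂P, ∀ k, k ≤ n → a k ω ≤ a n ω :=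
        ae_all_iff.2 fun k => eventually_imp_distrib_left.2 fun hk => (le_iff_ae _ _).1 (hm hk)
      filter_upwards [hmn, nrm_ae y] with ω h3 h4 h5
      obtain ⟨k, hk, h6⟩ := mem_accumulate.1 h5
      change c ≤ ‖y ω‖
      have h7 : a n = nrm y := by rw [← hn0, ← hya]
      rw [← h4, ← h7]
      exact le_trans h6 (h3 k hk)
    exact absurd ((measure_mono h1).trans h2)
      (not_le.2 (ENNReal.half_lt_self h0 (measure_ne_top _ _)))
  obtain ⟨ξ, h1, -⟩ := lub_of_seq ha hm hs (by rwa [ae_iff])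
  exact ⟨ξ, fun y hy => by rw [← hn0]; exact h1.1 ⟨y, hy, rfl⟩⟩


theorem bounded_of_compact [IsProbabilityMeasure P] {G : Set (Ω →ₘ[P] B)}
    (hG : ConvexlyCompact G) : ASBounded G := by
  by_contra hb
  obtain ⟨δ, hδ, hsp⟩ := unbdd_spread hG.1 hG.2.2.1 hb
  choose X hXG hX using hsp
  set x : ℕ → Ω →ₘ[P] B := fun n => X (3 ^ n * (4 * (n + 1))) with hx
  choose f hf1 hf2 hf3 using fun n => norming (x n)
  let sg : ℝ → ℝ := fun t => if 0 ≤ t then 1 else -1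
  have hsgm : Measurable sg := Measurable.ite measurableSet_Ici measurable_const measurable_const
  have hsg1 : ∀ t, |sg t| = 1 := by
    intro t
    simp only [sg]
    split_ifs <;> simp
  have hsg2 : ∀ t s, 0 ≤ s → s ≤ |t + sg t * s| := by
    intro t s hs
    simp only [sg]
    split_ifs with h
    · rw [abs_of_nonneg (by linarith)]
      linarith
    · push Not at h
      rw [abs_of_neg (by linarith)]
      linarith
  let F : ℕ → Ω → (B →L[ℝ] ℝ) := fun n => Nat.rec (fun _ => 0)
    (fun k g ω => g ω + ((1 / 3 : ℝ) ^ k * sg (g ω (x k ω))) • f k ω) n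
  have hFs : ∀ n ω, F (n + 1) ω = F n ω + ((1 / 3 : ℝ) ^ n * sg (F n ω (x n ω))) • f n ω :=
    fun n ω => rfl
  have hFm : ∀ n, StronglyMeasurable (F n) := by
    intro n
    induction n with
    | zero => exact stronglyMeasurable_const
    | succ k ih =>
      have h1 : StronglyMeasurable fun ω => F k ω (x k ω) :=
        isBoundedBilinearMap_apply.continuous.comp_stronglyMeasurable
          (ih.prodMk (x k).stronglyMeasurable)
      have h2 : StronglyMeasurable fun ω => ((1 / 3 : ℝ) ^ k * sg (F k ω (x k ω))) :=
        ((hsgm.comp h1.measurable).const_mul _).stronglyMeasurable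
      exact ih.add (h2.smul (hf1 k))
  have hdist : ∀ ω n, dist (F n ω) (F (n + 1) ω) ≤ 1 * (1 / 3 : ℝ) ^ n := by
    intro ω n
    rw [hFs, dist_eq_norm, sub_add_cancel_left, norm_neg, norm_smul, norm_mul, Real.norm_eq_abs,
      Real.norm_eq_abs, hsg1, abs_of_nonneg (by positivity), one_mul, mul_one]
    exact mul_le_of_le_one_right (by positivity) (hf2 n ω)
  have hcau : ∀ ω, ∃ L, Tendsto (fun n => F n ω) atTop (𝓝 L) := fun ω =>
    cauchySeq_tendsto_of_complete (cauchySeq_of_le_geometric _ _ (by norm_num) (hdist ω))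
  choose L hL using hcau
  have hLm : StronglyMeasurable L :=
    stronglyMeasurable_of_tendsto atTop hFm (tendsto_pi_nhds.2 hL)
  have hlow : ∀ n ω, (1 / 3 : ℝ) ^ n * ‖x n ω‖ / 4 ≤ |L ω (x n ω)| := by
    intro n ω
    have h1 : dist (F (n + 1) ω) (L ω) ≤ 1 * (1 / 3 : ℝ) ^ (n + 1) / (1 - 1 / 3) :=
      dist_le_of_le_geometric_of_tendsto _ _ (by norm_num) (hdist ω) (hL ω) (n + 1)
    have h2 : |F (n + 1) ω (x n ω) - L ω (x n ω)| ≤ ((1 / 3 : ℝ) ^ n / 2) * ‖x n ω‖ := by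
      have := (F (n + 1) ω - L ω).le_opNorm (x n ω)
      rw [← dist_eq_norm] at this
      refine this.trans ?_
      gcongr
      refine h1.trans (le_of_eq ?_)
      rw [pow_succ]
      ring
    have h3 : (1 / 3 : ℝ) ^ n * (3 / 4 * ‖x n ω‖) ≤ |F (n + 1) ω (x n ω)| := by
      have h4 : F (n + 1) ω (x n ω) = F n ω (x n ω) +
          sg (F n ω (x n ω)) * ((1 / 3 : ℝ) ^ n * f n ω (x n ω)) := by
        rw [hFs]
        simp
        ring
      rw [h4]
      have h5 : (1 / 3 : ℝ) ^ n * (3 / 4 * ‖x n ω‖) ≤ (1 / 3 : ℝ) ^ n * f n ω (x n ω) := by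
        gcongr
        exact hf3 n ω
      refine h5.trans (hsg2 _ _ (le_trans ?_ h5))
      positivity
    have h6 := abs_sub_abs_le_abs_sub (F (n + 1) ω (x n ω)) (L ω (x n ω))
    linarith
  obtain ⟨u, hu, hu2⟩ := functional_min hG L hLm
  obtain ⟨v, hv, hv2⟩ := functional_min hG (fun ω => - L ω) hLm.neg
  have hm : ∀ x : Ω →ₘ[P] B, AEStronglyMeasurable (fun ω => L ω (x ω)) P := fun x =>
    isBoundedBilinearMap_apply.continuous.comp_aestronglyMeasurable
      (hLm.aestronglyMeasurable.prodMk x.aestronglyMeasurable)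
  set η : Ω → ℝ := fun ω => |L ω (u ω)| + |L ω (v ω)| with hη
  have hηm : AEStronglyMeasurable η P := (hm u).norm.add (hm v).norm
  have hup : ∀ y ∈ G, ∀ᵐ ω ∂P, |L ω (y ω)| ≤ η ω := by
    intro y hy
    filter_upwards [hu2 y hy, hv2 y hy] with ω h1 h2
    simp only [neg_apply, neg_le_neg_iff] at h2
    have h3 := neg_abs_le (L ω (u ω))
    have h4 := le_abs_self (L ω (v ω))
    have h5 := abs_nonneg (L ω (u ω))
    have h6 := abs_nonneg (L ω (v ω))
    rw [abs_le]
    constructor <;> simp only [hη] <;> linarith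
  have hlim := tendstoInMeasure_of_tendsto_ae (μ := P)
    (f := fun (n : ℕ) ω => η ω * (1 / ((n : ℝ) + 1))) (g := fun _ => (0 : ℝ))
    (fun n => hηm.mul_const _) (Eventually.of_forall fun ω => by
      simpa using (tendsto_one_div_add_atTop_nhds_zero_nat (𝕜 := ℝ)).const_mul (η ω))
  rw [tendstoInMeasure_iff_norm] at hlim
  obtain ⟨n, hn⟩ := ((hlim 1 one_pos).eventually (gt_mem_nhds hδ)).exists
  refine absurd (hX (3 ^ n * (4 * (n + 1)))) (not_le.2 (lt_of_le_of_lt (measure_mono_ae ?_) hn))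
  filter_upwards [hup (x n) (hXG _)] with ω h1 (h2 : _ ≤ ‖x n ω‖)
  change (1 : ℝ) ≤ ‖η ω * (1 / ((n : ℝ) + 1)) - 0‖
  have h3 := (hlow n ω).trans h1
  have h4 : (1 / 3 : ℝ) ^ n * (3 ^ n * (4 * (n + 1))) ≤ (1 / 3 : ℝ) ^ n * ‖x n ω‖ := by gcongr
  rw [← mul_assoc, ← mul_pow] at h4
  norm_num at h4
  rw [sub_zero]
  refine le_trans ?_ (le_abs_self _)
  rw [mul_one_div, le_div_iff₀ (by positivity)]
  norm_num at h3
  linarith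


/-! Chebyshev centers -/

theorem Rr_le_iff [IsProbabilityMeasure P] {K : Set (Ω →ₘ[P] B)} (hne : K.Nonempty)
    (hK : LConvex K) (hb : ASBounded K) {x : Ω →ₘ[P] B} (hx : x ∈ K) (c : Ω →ₘ[P] ℝ) :
    Rr K x ≤ c ↔ ∀ y ∈ K, nrm (y - x) ≤ c := by
  rw [isLUB_le_iff (Rr_lub hne hK hb hx)]
  constructor
  · intro h y hy
    rw [nsub_comm]
    exact h ⟨y, hy, rfl⟩
  · rintro h _ ⟨y, hy, rfl⟩
    change nrm (x - y) ≤ c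
    rw [nsub_comm]
    exact h y hy

theorem cheb_min [IsProbabilityMeasure P] {G : Set (Ω →ₘ[P] B)} (hG : ConvexlyCompact G)
    {K : Set (Ω →ₘ[P] B)} (hKG : K ⊆ G) (hne : K.Nonempty) (hcl : SeqClosed K) (hK : LConvex K)
    (hb : ASBounded K) : ∃ x ∈ K, ∀ y ∈ K, Rr K x ≤ Rr K y := by
  have heq : ∀ c, {x ∈ K | Rr K x ≤ c} = {x ∈ K | ∀ y ∈ K, nrm (y - x) ≤ c} := by
    intro c
    ext x
    constructor
    · rintro ⟨h1, h2⟩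
      exact ⟨h1, (Rr_le_iff hne hK hb h1 c).1 h2⟩
    · rintro ⟨h1, h2⟩
      exact ⟨h1, (Rr_le_iff hne hK hb h1 c).2 h2⟩
  refine min_exists hG hKG hne (Rr K) ?_ ?_ ?_
  · intro y _
    rw [heq]
    exact cheb_closed hcl _ _
  · intro y _
    rw [heq]
    exact cheb_conv hK _ _
  · intro x hx y hy
    obtain ⟨A, hA, hA2⟩ := measSet (Rr K x) (Rr K y)
    obtain ⟨z, hz, hzz⟩ := glue hK hx hy hA
    have hx2 := (Rr_le_iff hne hK hb hx _).1 le_rfl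
    have hy2 := (Rr_le_iff hne hK hb hy _).1 le_rfl
    refine ⟨z, hz, (Rr_le_iff hne hK hb hz _).2 ?_, (Rr_le_iff hne hK hb hz _).2 ?_⟩ <;>
    · intro w hw
      rw [nsub_le_iff]
      filter_upwards [hA2, hzz, (nsub_le_iff _ _ _).1 (hx2 w hw), (nsub_le_iff _ _ _).1 (hy2 w hw)]
        with ω h1 h2 h3 h4
      by_cases h : ω ∈ A
      · have := h1.1 h
        rw [h2.1 h]
        linarith
      · have := mt h1.2 h
        rw [h2.2 h]
        linarith

/-! The semigroup -/

inductive Gen (𝒯 : Set ((Ω →ₘ[P] B) → (Ω →ₘ[P] B))) : ((Ω →ₘ[P] B) → (Ω →ₘ[P] B)) → Prop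
  | base : Gen 𝒯 (fun x => x)
  | step (T s : (Ω →ₘ[P] B) → (Ω →ₘ[P] B)) (hT : T ∈ 𝒯) (hs : Gen 𝒯 s) : Gen 𝒯 (fun x => T (s x))

structure MinSet (𝒯 : Set ((Ω →ₘ[P] B) → (Ω →ₘ[P] B))) (K : Set (Ω →ₘ[P] B)) : Prop where
  ne : K.Nonempty
  cl : SeqClosed K
  cv : LConvex K
  maps : ∀ T ∈ 𝒯, MapsTo T K K
  nonexp : ∀ T ∈ 𝒯, NonexpansiveOn K T
  comm : ∀ T ∈ 𝒯, ∀ S ∈ 𝒯, ∀ x ∈ K, T (S x) = S (T x)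
  min : ∀ K' ⊆ K, K'.Nonempty → SeqClosed K' → LConvex K' → (∀ T ∈ 𝒯, MapsTo T K' K') → K ⊆ K'

section
variable {𝒯 : Set ((Ω →ₘ[P] B) → (Ω →ₘ[P] B))} {K : Set (Ω →ₘ[P] B)}

theorem Gen.comp {s t : (Ω →ₘ[P] B) → (Ω →ₘ[P] B)} (hs : Gen 𝒯 s) (ht : Gen 𝒯 t) :
    Gen 𝒯 (fun x => s (t x)) := by
  induction hs with
  | base => exact ht
  | step T s hT hs ih => exact Gen.step T _ hT ih

theorem Gen.maps {s : (Ω →ₘ[P] B) → (Ω →ₘ[P] B)} (hs : Gen 𝒯 s) (m : MinSet 𝒯 K) :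
    MapsTo s K K := by
  induction hs with
  | base => exact fun x hx => hx
  | step T s hT hs ih => exact fun x hx => m.maps T hT (ih hx)

theorem Gen.nonexp {s : (Ω →ₘ[P] B) → (Ω →ₘ[P] B)} (hs : Gen 𝒯 s) (m : MinSet 𝒯 K) :
    NonexpansiveOn K s := by
  induction hs with
  | base => exact fun x hx y hy => le_rfl
  | step T s hT hs ih =>
    exact fun x hx y hy => (m.nonexp T hT _ (hs.maps m hx) _ (hs.maps m hy)).trans (ih x hx y hy)

theorem Gen.comm1 {s : (Ω →ₘ[P] B) → (Ω →ₘ[P] B)} (hs : Gen 𝒯 s) (m : MinSet 𝒯 K)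
    {T : (Ω →ₘ[P] B) → (Ω →ₘ[P] B)} (hT : T ∈ 𝒯) : ∀ x ∈ K, s (T x) = T (s x) := by
  induction hs with
  | base => exact fun x hx => rfl
  | step S s hS hs ih =>
    intro x hx
    change S (s (T x)) = T (S (s x))
    rw [ih x hx, m.comm S hS T hT _ (hs.maps m hx)]

theorem Gen.comm {s t : (Ω →ₘ[P] B) → (Ω →ₘ[P] B)} (hs : Gen 𝒯 s) (ht : Gen 𝒯 t)
    (m : MinSet 𝒯 K) : ∀ x ∈ K, s (t x) = t (s x) := by
  induction ht with
  | base => exact fun x hx => rfl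
  | step T t hT ht ih =>
    intro x hx
    change s (T (t x)) = T (t (s x))
    rw [hs.comm1 m hT _ (ht.maps m hx), ih x hx]

def NN (𝒯 : Set ((Ω →ₘ[P] B) → (Ω →ₘ[P] B))) (K : Set (Ω →ₘ[P] B)) (c : Ω →ₘ[P] ℝ) :
    Set (Ω →ₘ[P] B) := {z ∈ K | ∃ t, Gen 𝒯 t ∧ ∀ w ∈ K, nrm (t w - z) ≤ c}

theorem NN_conv (m : MinSet 𝒯 K) (c : Ω →ₘ[P] ℝ) : LConvex (NN 𝒯 K c) := by
  rintro x ⟨hx, t, ht, htx⟩ y ⟨hy, s, hs, hsy⟩ l h0 h1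
  refine ⟨m.cv x hx y hy l h0 h1, _, ht.comp hs, ?_⟩
  intro w hw
  refine ball_conv (t (s w)) c x (htx _ (hs.maps m hw)) y ?_ l h0 h1
  rw [ht.comm hs m w hw]
  exact hsy _ (ht.maps m hw)

theorem NN_maps (m : MinSet 𝒯 K) (c : Ω →ₘ[P] ℝ) {s : (Ω →ₘ[P] B) → (Ω →ₘ[P] B)}
    (hs : Gen 𝒯 s) : MapsTo s (NN 𝒯 K c) (NN 𝒯 K c) := by
  rintro x ⟨hx, t, ht, htx⟩
  exact ⟨hs.maps m hx, _, hs.comp ht, fun w hw =>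
    (hs.nonexp m _ (ht.maps m hw) _ hx).trans (htx w hw)⟩

theorem cl_maps [IsProbabilityMeasure P] {S S' : Set (Ω →ₘ[P] B)} (hSK : S ⊆ K)
    {s : (Ω →ₘ[P] B) → (Ω →ₘ[P] B)}
    (hs : NonexpansiveOn K s) (hss : ∀ x ∈ S, s x ∈ S') {x : Ω →ₘ[P] B} (hxK : x ∈ K)
    (hx : x ∈ seqClosure S) : s x ∈ seqClosure S' := by
  refine cl_transfer hx fun y hy => ⟨s y, hss y hy, ?_⟩
  filter_upwards [(nsub_le_iff _ _ _).1 (hs y (hSK hy) x hxK), nsub_ae y x] with ω h1 h2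
  rwa [← h2]

theorem NN_sub (c : Ω →ₘ[P] ℝ) : NN 𝒯 K c ⊆ K := fun _ h => h.1

theorem NN_dense [IsProbabilityMeasure P] (m : MinSet 𝒯 K) (c : Ω →ₘ[P] ℝ)
    (hne : (NN 𝒯 K c).Nonempty) : K ⊆ seqClosure (NN 𝒯 K c) := by
  have hs : seqClosure (NN 𝒯 K c) ⊆ K := cl_sub m.cl (NN_sub c)
  refine m.min _ hs (hne.mono (sub_cl _)) (cl_closed _) (cl_conv (NN_conv m c)) ?_
  intro T hT x hx
  exact cl_maps (NN_sub c) (m.nonexp T hT)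
    (fun y hy => NN_maps m c (Gen.step T _ hT Gen.base) hy) (hs hx) hx

theorem NN_low [IsProbabilityMeasure P] {G : Set (Ω →ₘ[P] B)} (hG : ConvexlyCompact G)
    (hKG : K ⊆ G) (m : MinSet 𝒯 K) (c : Ω →ₘ[P] ℝ)
    (hne : (NN 𝒯 K c).Nonempty) : ∃ d ∈ K, ∀ z ∈ K, nrm (z - d) ≤ c := by
  obtain ⟨d, hd⟩ := compact_dir hG (F := {C | ∃ t, Gen 𝒯 t ∧ C = hull (t '' K)}) (by
      rintro _ ⟨t, ht, rfl⟩
      exact ⟨(m.ne.image t).mono (subset_hull _),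
        (hull_subset m.cl m.cv (ht.maps m).image_subset).trans hKG, hull_closed _, hull_conv _⟩) (by
      rintro _ ⟨t, ht, rfl⟩ _ ⟨s, hs, rfl⟩
      refine ⟨_, ⟨_, ht.comp hs, rfl⟩, hull_subset (hull_closed _) (hull_conv _) ?_,
        hull_subset (hull_closed _) (hull_conv _) ?_⟩
      · rintro _ ⟨w, hw, rfl⟩
        exact subset_hull _ ⟨s w, hs.maps m hw, rfl⟩
      · rintro _ ⟨w, hw, rfl⟩
        refine subset_hull _ ⟨t w, ht.maps m hw, ?_⟩
        exact (ht.comm hs m w hw).symm)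
  have hdK : d ∈ K :=
    hull_subset m.cl m.cv (by rintro _ ⟨w, hw, rfl⟩; exact hw) (hd _ ⟨_, Gen.base, rfl⟩)
  refine ⟨d, hdK, fun z hz => ?_⟩
  rw [nsub_comm]
  refine cl_sub (ball_closed d c) ?_ (NN_dense m c hne hz)
  rintro y ⟨hy, t, ht, hty⟩
  change nrm (d - y) ≤ c
  rw [nsub_comm]
  refine hull_subset (ball_closed y c) (ball_conv y c) ?_ (hd _ ⟨t, ht, rfl⟩)
  rintro _ ⟨w, hw, rfl⟩
  change nrm (y - t w) ≤ c
  rw [nsub_comm]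
  exact hty w hw

theorem LConvex.convex (hK : LConvex K) : Convex ℝ K := by
  intro x hx y hy a b ha hb hab
  have hc : ∀ᵐ ω ∂P, (AEEqFun.const Ω a : Ω →ₘ[P] ℝ) ω = a := AEEqFun.coeFn_const _ _
  have := hK x hx y hy (AEEqFun.const Ω a) (by
    rw [le_iff_ae]
    filter_upwards [hc, AEEqFun.coeFn_zero (α := Ω) (β := ℝ) (μ := P)] with ω h1 h2
    rw [h1, h2]
    exact ha) (by
    rw [le_iff_ae]
    filter_upwards [hc, AEEqFun.coeFn_one (α := Ω) (β := ℝ) (μ := P)] with ω h1 h2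
    rw [h1, h2]
    change a ≤ 1
    linarith)
  convert this using 1
  apply AEEqFun.ext
  filter_upwards [comb_ae (AEEqFun.const Ω a) x y, hc, add_ae (a • x) (b • y), smul_ae a x,
    smul_ae b y] with ω h1 h2 h3 h4 h5
  rw [h1, h2, h3, h4, h5, ← hab]
  simp

theorem smulR_ae (c : ℝ) (x : Ω →ₘ[P] ℝ) : ∀ᵐ ω ∂P, (c • x) ω = c * x ω :=
  AEEqFun.coeFn_smul c x

theorem nn_common (m : MinSet 𝒯 K) (c : Ω →ₘ[P] ℝ) (x : ℕ → Ω →ₘ[P] B) (n : ℕ)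
    (hx : ∀ i < n, x i ∈ NN 𝒯 K c) :
    ∃ s, Gen 𝒯 s ∧ ∀ i < n, ∀ w ∈ K, nrm (s w - x i) ≤ c := by
  induction n with
  | zero => exact ⟨_, Gen.base, by simp⟩
  | succ n ih =>
    obtain ⟨s, hs, h⟩ := ih fun i hi => hx i (by omega)
    obtain ⟨-, t, ht, htx⟩ := hx n (by omega)
    refine ⟨_, hs.comp ht, ?_⟩
    intro i hi w hw
    rcases Nat.lt_succ_iff_lt_or_eq.1 hi with h' | rfl
    · exact h i h' _ (ht.maps m hw)
    · rw [hs.comm ht m w hw]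
      exact htx _ (hs.maps m hw)

theorem step_exists [IsProbabilityMeasure P] (m : MinSet 𝒯 K) (hb : ASBounded K)
    (ρ : Ω →ₘ[P] ℝ) (hne : (NN 𝒯 K ρ).Nonempty) (hρ : ∀ c, (NN 𝒯 K c).Nonempty → ρ ≤ c)
    (n : ℕ) (x : ℕ → Ω →ₘ[P] B) (hx : ∀ i < n, x i ∈ NN 𝒯 K ρ) :
    ∃ v ∈ NN 𝒯 K ρ, (∀ i < n, nrm (x i - v) ≤ ρ) ∧
      P {ω | nrm (∑ i ∈ Finset.range n, x i - (n : ℝ) • v) ω + 1 / ((n : ℝ) + 1) ≤ ((n : ℝ) • ρ) ω}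
        ≤ ENNReal.ofReal (1 / ((n : ℝ) + 1)) := by
  rcases Nat.eq_zero_or_pos n with rfl | hn
  · obtain ⟨v, hv⟩ := hne
    refine ⟨v, hv, by simp, ?_⟩
    simpa using prob_le_one
  obtain ⟨s, hs, hsx⟩ := nn_common m ρ x n hx
  set U := ∑ i ∈ Finset.range n, x i with hU
  have hn' : (0 : ℝ) < n := by exact_mod_cast hn
  have huK : (1 / (n : ℝ)) • U ∈ K := by
    rw [hU, Finset.smul_sum]
    refine m.cv.convex.sum_mem (fun i _ => by positivity) ?_ fun i hi =>
      (hx i (Finset.mem_range.1 hi)).1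
    simp
    field_simp
  have hnm : ∀ w, ∀ᵐ ω ∂P, nrm (U - (n : ℝ) • s w) ω = ‖U ω - (n : ℝ) • s w ω‖ := by
    intro w
    filter_upwards [nsub_ae U ((n : ℝ) • s w), smul_ae (n : ℝ) (s w)] with ω h1 h2
    rw [h1, h2]
  obtain ⟨_, ⟨w, hw, rfl⟩, ha⟩ := approx_dir (S := (fun w => nrm (U - (n : ℝ) • s w)) '' NN 𝒯 K ρ)
    (hne.image _) (by
      rintro _ ⟨y, hy, rfl⟩ _ ⟨y', hy', rfl⟩
      obtain ⟨A, hA, hA2⟩ := measSet (nrm (U - (n : ℝ) • s y)) (nrm (U - (n : ℝ) • s y'))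
      obtain ⟨z, hz, hzz⟩ := glue (NN_conv m ρ) hy' hy hA
      refine ⟨_, ⟨z, hz, rfl⟩, (le_iff_ae _ _).2 ?_, (le_iff_ae _ _).2 ?_⟩ <;>
      · filter_upwards [hA2, hzz, hnm y, hnm y', hnm z,
          (nsub_le_iff _ _ _).1 (hs.nonexp m z hz.1 y hy.1), nsub_ae z y,
          (nsub_le_iff _ _ _).1 (hs.nonexp m z hz.1 y' hy'.1), nsub_ae z y']
          with ω h1 h2 h3 h4 h5 h6 h7 h8 h9
        simp only [h3, h4] at h1
        simp only [h3, h4, h5]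
        rw [h7] at h6
        rw [h9] at h8
        by_cases h : ω ∈ A
        · have := h1.1 h
          rw [h2.1 h, sub_self, norm_zero, norm_le_zero_iff, sub_eq_zero] at h8
          rw [h8] <;> linarith
        · have := mt h1.2 h
          rw [h2.2 h, sub_self, norm_zero, norm_le_zero_iff, sub_eq_zero] at h6
          rw [h6] <;> linarith) (by
      obtain ⟨ξ, hξ⟩ := hb
      refine ⟨nrm U + (n : ℝ) • ξ, ?_⟩
      rintro _ ⟨y, hy, rfl⟩
      rw [le_iff_ae]
      filter_upwards [hnm y, AEEqFun.coeFn_add (nrm U) ((n : ℝ) • ξ), nrm_ae U, smulR_ae (n : ℝ) ξ,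
        (nrm_le_iff _ _).1 (hξ _ (hs.maps m hy.1))] with ω h1 h2 h3 h4 h5
      simp only [h1, h2, Pi.add_apply, h3, h4]
      refine (norm_sub_le _ _).trans ?_
      rw [norm_smul, Real.norm_of_nonneg hn'.le]
      gcongr) ((n : ℝ) • ρ) (by
      intro c hc
      have h1 : (1 / (n : ℝ)) • U ∈ NN 𝒯 K ((1 / (n : ℝ)) • c) := by
        refine ⟨huK, s, hs, ?_⟩
        intro w hw
        rw [nsub_comm]
        refine cl_sub (S := s '' NN 𝒯 K ρ) (ball_closed ((1 / (n : ℝ)) • U) ((1 / (n : ℝ)) • c)) ?_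
          (cl_maps (NN_sub ρ) (hs.nonexp m) (fun y hy => mem_image_of_mem s hy) hw (NN_dense m ρ hne hw))
        rintro _ ⟨y, hy, rfl⟩
        refine (nsub_le_iff _ _ _).2 ?_
        have hcy : nrm (U - (n : ℝ) • s y) ≤ c := mem_upperBounds.1 hc _ ⟨y, hy, rfl⟩
        filter_upwards [(le_iff_ae _ _).1 hcy, hnm y, smulR_ae (1 / (n : ℝ)) c,
          smul_ae (1 / (n : ℝ)) U] with ω h1 h2 h3 h4
        rw [h3, h4]
        rw [h2] at h1
        have : (1 / (n : ℝ)) • U ω - s y ω = (1 / (n : ℝ)) • (U ω - (n : ℝ) • s y ω) := by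
          rw [smul_sub, smul_smul]
          congr 1
          rw [one_div, inv_mul_cancel₀ hn'.ne', one_smul]
        rw [this, norm_smul, Real.norm_of_nonneg (by positivity)]
        gcongr
      rw [le_iff_ae]
      filter_upwards [(le_iff_ae _ _).1 (hρ _ ⟨_, h1⟩), smulR_ae (1 / (n : ℝ)) c,
        smulR_ae (n : ℝ) ρ] with ω h1 h2 h3
      rw [h2] at h1
      rw [h3]
      calc (n : ℝ) * ρ ω ≤ n * (1 / (n : ℝ) * c ω) := by gcongr
        _ = c ω := by field_simp) (1 / ((n : ℝ) + 1)) (by positivity)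
  refine ⟨s w, NN_maps m ρ hs hw, ?_, ha⟩
  intro i hi
  rw [nsub_comm]
  exact hsx i hi w hw.1

end


theorem seq_rec {α : Type*} (Q : ℕ → (ℕ → α) → α → Prop) (N : Set α)
    (hloc : ∀ n f g v, (∀ i < n, f i = g i) → Q n f v → Q n g v)
    (h : ∀ n (f : ℕ → α), (∀ i < n, f i ∈ N) → ∃ v ∈ N, Q n f v) (a : α) (ha : a ∈ N) :
    ∃ x : ℕ → α, ∀ n, x n ∈ N ∧ Q n x (x n) := by
  have h' : ∀ n (f : {f : ℕ → α // ∀ i, f i ∈ N}), ∃ v, v ∈ N ∧ Q n f.1 v := fun n f =>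
    h n f.1 fun i _ => f.2 i
  choose F hF hQ using h'
  let g : ℕ → {f : ℕ → α // ∀ i, f i ∈ N} := fun n => Nat.rec ⟨fun _ => a, fun _ => ha⟩
    (fun n f => ⟨update f.1 n (F n f), by
      intro i
      by_cases hi : i = n
      · subst hi
        simpa using hF _ _
      · simpa [hi] using f.2 i⟩) n
  have hg : ∀ n, (g (n + 1)).1 = update (g n).1 n (F n (g n)) := fun n => rfl
  have hx : ∀ n, (g (n + 1)).1 n = F n (g n) := fun n => by rw [hg]; simp
  have hst : ∀ i m, i < m → (g m).1 i = (g (i + 1)).1 i := by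
    intro i m him
    induction m, him using Nat.le_induction with
    | base => rfl
    | succ m hm ih =>
      rw [← ih, hg, update_of_ne (by omega)]
  refine ⟨fun n => (g (n + 1)).1 n, fun n => ⟨(g (n + 1)).2 n, ?_⟩⟩
  refine hloc n (g n).1 _ _ (fun i hi => hst i n hi) ?_
  simp only [hx]
  exact hQ n (g n)

theorem sum_ae {ι : Type*} (s : Finset ι) (y : ι → Ω →ₘ[P] B) :
    ∀ᵐ ω ∂P, (∑ i ∈ s, y i) ω = ∑ i ∈ s, y i ω := by
  induction s using Finset.induction_on with
  | empty =>
    filter_upwards [AEEqFun.coeFn_zero (α := Ω) (β := B) (μ := P)] with ω h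
    simpa using h
  | insert i s hi ih =>
    rw [Finset.sum_insert hi]
    filter_upwards [ih, add_ae (y i) (∑ i ∈ s, y i)] with ω h1 h2
    rw [h2, h1, Finset.sum_insert hi]

def ZZ (x : ℕ → Ω →ₘ[P] B) (ρ : Ω →ₘ[P] ℝ) : Set (Ω →ₘ[P] B) :=
  {z | ∃ k : ℕ, ∀ n, k < n →
    z ∈ Ball (∑ i ∈ Finset.range n, x i - ((n : ℝ) - 1) • x n) (((n : ℝ) - 1) • ρ)}

theorem ZZ_conv (x : ℕ → Ω →ₘ[P] B) (ρ : Ω →ₘ[P] ℝ) : LConvex (ZZ x ρ) := by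
  rintro y ⟨k, hk⟩ z ⟨k', hk'⟩ l h0 h1
  exact ⟨max k k', fun n hn => ball_conv _ _ _ (hk n (lt_of_le_of_lt (le_max_left _ _) hn)) _
    (hk' n (lt_of_le_of_lt (le_max_right _ _) hn)) l h0 h1⟩

theorem ZZ_mem (x : ℕ → Ω →ₘ[P] B) (ρ : Ω →ₘ[P] ℝ)
    (hx : ∀ n, ∀ i < n, nrm (x i - x n) ≤ ρ) (j : ℕ) : x j ∈ ZZ x ρ := by
  refine ⟨j, fun n hn => (nsub_le_iff _ _ _).2 ?_⟩
  have h1 : ∀ᵐ ω ∂P, ∀ i, i < n → ‖x i ω - x n ω‖ ≤ ρ ω := by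
    rw [ae_all_iff]
    intro i
    by_cases hi : i < n
    · filter_upwards [(nsub_le_iff _ _ _).1 (hx n i hi)] with ω h _ using h
    · exact Eventually.of_forall fun ω h => absurd h hi
  filter_upwards [h1, sum_ae (Finset.range n) x, smul_ae ((n : ℝ) - 1) (x n),
    smulR_ae ((n : ℝ) - 1) ρ, sub_ae (∑ i ∈ Finset.range n, x i) (((n : ℝ) - 1) • x n)]
    with ω h1 h2 h3 h4 h5
  rw [h5, h4, h3, h2]
  have hjm : j ∈ Finset.range n := Finset.mem_range.2 hn
  have hc : (((Finset.range n).erase j).card : ℝ) = (n : ℝ) - 1 := by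
    rw [Finset.card_erase_of_mem hjm, Finset.card_range, Nat.cast_sub (by omega)]
    simp
  have : ∑ i ∈ Finset.range n, x i ω - ((n : ℝ) - 1) • x n ω - x j ω
      = ∑ i ∈ (Finset.range n).erase j, (x i ω - x n ω) := by
    rw [Finset.sum_sub_distrib, Finset.sum_const, ← Finset.add_sum_erase _ _ hjm,
      ← Nat.cast_smul_eq_nsmul ℝ, hc]
    abel
  rw [this, ← hc]
  calc _ ≤ ∑ i ∈ (Finset.range n).erase j, ‖x i ω - x n ω‖ := norm_sum_le _ _
    _ ≤ ∑ i ∈ (Finset.range n).erase j, ρ ω :=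
        Finset.sum_le_sum fun i hi => h1 i (Finset.mem_range.1 (Finset.mem_of_mem_erase hi))
    _ = _ := by rw [Finset.sum_const, nsmul_eq_mul]

theorem ZZ_low [IsProbabilityMeasure P] (x : ℕ → Ω →ₘ[P] B) (ρ : Ω →ₘ[P] ℝ)
    (hP : ∀ n : ℕ, P {ω | nrm (∑ i ∈ Finset.range n, x i - (n : ℝ) • x n) ω + 1 / ((n : ℝ) + 1)
      ≤ ((n : ℝ) • ρ) ω} ≤ ENNReal.ofReal (1 / ((n : ℝ) + 1)))
    {z : Ω →ₘ[P] B} (hz : z ∈ ZZ x ρ) {c : Ω →ₘ[P] ℝ} (hc : ∀ m, nrm (z - x m) ≤ c) : ρ ≤ c := by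
  obtain ⟨k, hk⟩ := hz
  have h1 : ∀ n, k < n → P {ω | c ω + 1 / ((n : ℝ) + 1) ≤ ρ ω} ≤ ENNReal.ofReal (1 / ((n : ℝ) + 1)) := by
    intro n hn
    refine (measure_mono_ae ?_).trans (hP n)
    filter_upwards [(nsub_le_iff _ _ _).1 (hk n hn), (nsub_le_iff _ _ _).1 (hc n),
      smul_ae ((n : ℝ) - 1) (x n), smul_ae (n : ℝ) (x n), smulR_ae (n : ℝ) ρ,
      smulR_ae ((n : ℝ) - 1) ρ, sub_ae (∑ i ∈ Finset.range n, x i) (((n : ℝ) - 1) • x n),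
      nsub_ae (∑ i ∈ Finset.range n, x i) ((n : ℝ) • x n)] with ω h1 h2 h3 h4 h5 h6 h7 h8
    intro (h : c ω + 1 / ((n : ℝ) + 1) ≤ ρ ω)
    change _ + _ ≤ _
    rw [h7, h6, h3] at h1
    rw [h8, h5, h4]
    have e : (∑ i ∈ Finset.range n, x i) ω - (n : ℝ) • x n ω
      = ((∑ i ∈ Finset.range n, x i) ω - ((n : ℝ) - 1) • x n ω - z ω) + (z ω - x n ω) := by
      rw [sub_smul, one_smul]
      abel
    have := norm_add_le ((∑ i ∈ Finset.range n, x i) ω - ((n : ℝ) - 1) • x n ω - z ω) (z ω - x n ω)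
    rw [← e] at this
    linarith
  have h2 : ∀ j : ℕ, P {ω | c ω + 1 / ((j : ℝ) + 1) ≤ ρ ω} = 0 := by
    intro j
    have hl : Tendsto (fun n : ℕ => ENNReal.ofReal (1 / ((n : ℝ) + 1))) atTop (𝓝 0) := by
      have := ENNReal.tendsto_ofReal (tendsto_one_div_add_atTop_nhds_zero_nat (𝕜 := ℝ))
      simpa using this
    refine le_antisymm (ge_of_tendsto hl ?_) zero_le
    filter_upwards [eventually_gt_atTop k, eventually_ge_atTop j] with n hn hj
    refine le_trans (measure_mono ?_) (h1 n hn)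
    intro ω (h : c ω + 1 / ((j : ℝ) + 1) ≤ ρ ω)
    change c ω + 1 / ((n : ℝ) + 1) ≤ ρ ω
    have : 1 / ((n : ℝ) + 1) ≤ 1 / ((j : ℝ) + 1) := by gcongr
    linarith
  rw [le_iff_ae]
  have h3 : ∀ᵐ ω ∂P, ∀ j : ℕ, ρ ω < c ω + 1 / ((j : ℝ) + 1) := by
    rw [ae_all_iff]
    intro j
    rw [ae_iff]
    simpa only [not_lt] using h2 j
  filter_upwards [h3] with ω h
  refine le_of_forall_pos_le_add fun ε hε => ?_
  obtain ⟨j, hj⟩ := exists_nat_one_div_lt hε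
  linarith [h j]

theorem hull_low [IsProbabilityMeasure P] (x : ℕ → Ω →ₘ[P] B) (ρ : Ω →ₘ[P] ℝ)
    (hx : ∀ n, ∀ i < n, nrm (x i - x n) ≤ ρ)
    (hP : ∀ n : ℕ, P {ω | nrm (∑ i ∈ Finset.range n, x i - (n : ℝ) • x n) ω + 1 / ((n : ℝ) + 1)
      ≤ ((n : ℝ) • ρ) ω} ≤ ENNReal.ofReal (1 / ((n : ℝ) + 1)))
    {z : Ω →ₘ[P] B} (hz : z ∈ hull (range x)) {c : Ω →ₘ[P] ℝ} (hc : ∀ m, nrm (z - x m) ≤ c) :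
    ρ ≤ c := by
  have hz2 : z ∈ seqClosure (ZZ x ρ) := by
    refine hull_subset (cl_closed _) (cl_conv (ZZ_conv x ρ)) ?_ hz
    rintro _ ⟨j, rfl⟩
    exact sub_cl _ (ZZ_mem x ρ hx j)
  obtain ⟨y, hy, hlim⟩ := hz2
  obtain ⟨ns, -, hns⟩ := hlim.exists_seq_tendsto_ae
  have h1 : ∀ j, ρ ≤ c + nrm (y j - z) := by
    intro j
    refine ZZ_low x ρ hP (hy j) fun m => (nsub_le_iff _ _ _).2 ?_
    filter_upwards [(nsub_le_iff _ _ _).1 (hc m), AEEqFun.coeFn_add c (nrm (y j - z)),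
      nsub_ae (y j) z] with ω h1 h2 h3
    rw [h2, Pi.add_apply, h3]
    linarith [norm_sub_le_norm_sub_add_norm_sub (y j ω) (z ω) (x m ω)]
  have h2 : ∀ᵐ ω ∂P, ∀ j, ρ ω ≤ c ω + ‖y j ω - z ω‖ := by
    rw [ae_all_iff]
    intro j
    filter_upwards [(le_iff_ae _ _).1 (h1 j), AEEqFun.coeFn_add c (nrm (y j - z)),
      nsub_ae (y j) z] with ω h1 h2 h3
    rwa [h2, Pi.add_apply, h3] at h1
  rw [le_iff_ae]
  filter_upwards [h2, hns] with ω h3 h4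
  have h5 : Tendsto (fun i => c ω + ‖y (ns i) ω - z ω‖) atTop (𝓝 (c ω + ‖z ω - z ω‖)) :=
    tendsto_const_nhds.add (h4.sub_const _).norm
  have := ge_of_tendsto' h5 (fun i => h3 (ns i))
  simpa using this

theorem rho_zero [IsProbabilityMeasure P] {G K : Set (Ω →ₘ[P] B)}
    {𝒯 : Set ((Ω →ₘ[P] B) → (Ω →ₘ[P] B))} (hns : RandNormalStructure G) (hKG : K ⊆ G)
    (m : MinSet 𝒯 K) (hb : ASBounded K)
    (ρ : Ω →ₘ[P] ℝ) (hne : (NN 𝒯 K ρ).Nonempty) (hρ : ∀ c, (NN 𝒯 K c).Nonempty → ρ ≤ c) :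
    ρ ≤ 0 := by
  obtain ⟨a, ha⟩ := hne
  obtain ⟨x, hx⟩ := seq_rec (fun n f v => (∀ i < n, nrm (f i - v) ≤ ρ) ∧
      P {ω | nrm (∑ i ∈ Finset.range n, f i - (n : ℝ) • v) ω + 1 / ((n : ℝ) + 1) ≤ ((n : ℝ) • ρ) ω}
        ≤ ENNReal.ofReal (1 / ((n : ℝ) + 1))) (NN 𝒯 K ρ) (by
      rintro n f g v hfg ⟨h1, h2⟩
      refine ⟨fun i hi => hfg i hi ▸ h1 i hi, ?_⟩
      rwa [← Finset.sum_congr rfl fun i hi => hfg i (Finset.mem_range.1 hi)])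
    (fun n f hf => step_exists m hb ρ ⟨a, ha⟩ hρ n f hf) a ha
  have hx1 : ∀ n, ∀ i < n, nrm (x i - x n) ≤ ρ := fun n => (hx n).2.1
  have hρ0 : ∀ᵐ ω ∂P, 0 ≤ ρ ω := by
    filter_upwards [(nsub_le_iff _ _ _).1 (hx1 1 0 one_pos)] with ω h
    exact (norm_nonneg _).trans h
  have hall : ∀ i j, nrm (x i - x j) ≤ ρ := by
    intro i j
    rcases lt_trichotomy i j with h | h | h
    · exact hx1 j i h
    · subst h
      refine (nsub_le_iff _ _ _).2 ?_
      filter_upwards [hρ0] with ω h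
      simpa using h
    · rw [nsub_comm]
      exact hx1 i j h
  set H := hull (range x) with hH
  have hHK : H ⊆ K := by
    refine hull_subset m.cl m.cv ?_
    rintro _ ⟨n, rfl⟩
    exact (hx n).1.1
  have hHne : H.Nonempty := ⟨x 0, subset_hull _ ⟨0, rfl⟩⟩
  have hHb : ASBounded H := by
    obtain ⟨ξ, hξ⟩ := hb
    exact ⟨ξ, fun h hh => hξ h (hHK hh)⟩
  have hd1 : ∀ i, ∀ b ∈ H, nrm (x i - b) ≤ ρ := by
    intro i b hb
    refine hull_subset (ball_closed (x i) ρ) (ball_conv (x i) ρ) ?_ hb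
    rintro _ ⟨n, rfl⟩
    exact hall i n
  have hd2 : ∀ b ∈ H, ∀ b' ∈ H, nrm (b - b') ≤ ρ := by
    intro b hb b' hb'
    refine hull_subset (ball_closed b ρ) (ball_conv b ρ) ?_ hb'
    rintro _ ⟨n, rfl⟩
    change nrm (b - x n) ≤ ρ
    rw [nsub_comm]
    exact hd1 n b hb
  have hD := Dd_lub hHne (hull_conv _) hHb
  have hDρ : Dd H ≤ ρ := by
    refine (isLUB_le_iff hD).2 ?_
    rintro _ ⟨b, hb, b', hb', rfl⟩
    exact hd2 b hb b' hb'
  have hlow : ∀ z ∈ H, ρ ≤ Rr H z := by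
    intro z hz
    refine hull_low x ρ hx1 (fun n => (hx n).2.2) hz fun j => ?_
    exact (Rr_lub hHne (hull_conv _) hHb hz).1 ⟨x j, subset_hull _ ⟨j, rfl⟩, rfl⟩
  have hRD : ∀ z ∈ H, Rr H z ≤ Dd H := by
    intro z hz
    refine (isLUB_le_iff (Rr_lub hHne (hull_conv _) hHb hz)).2 ?_
    rintro _ ⟨y, hy, rfl⟩
    exact hD.1 ⟨z, hz, y, hy, rfl⟩
  by_cases h0 : Dd H = 0
  · rw [← h0]
    obtain ⟨z, hz⟩ := hHne
    exact (hlow z hz).trans (hRD z hz)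
  · obtain ⟨z, hz, hlt⟩ := hns H (hHK.trans hKG) hHne hHb (hull_closed _) (hull_conv _) h0
    rw [le_iff_ae]
    filter_upwards [hlt, (le_iff_ae _ _).1 (hlow z hz), (le_iff_ae _ _).1 (hRD z hz),
      (le_iff_ae _ _).1 hDρ, AEEqFun.coeFn_zero (α := Ω) (β := ℝ) (μ := P)] with ω h1 h2 h3 h4 h5
    rw [h5]
    change ρ ω ≤ 0
    by_contra hcon
    push Not at hcon
    have := h1 (by linarith)
    linarith

theorem fixed_of_min [IsProbabilityMeasure P] {G K : Set (Ω →ₘ[P] B)}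
    {𝒯 : Set ((Ω →ₘ[P] B) → (Ω →ₘ[P] B))} (hG : ConvexlyCompact G)
    (hns : RandNormalStructure G) (hKG : K ⊆ G) (m : MinSet 𝒯 K) (hb : ASBounded K) :
    ∃ x ∈ K, ∀ T ∈ 𝒯, T x = x := by
  obtain ⟨x, hx, hmin⟩ := cheb_min hG hKG m.ne m.cl m.cv hb
  have hxr := (Rr_le_iff m.ne m.cv hb hx _).1 le_rfl
  have h0 := rho_zero hns hKG m hb (Rr K x) ⟨x, hx, _, Gen.base, hxr⟩ (by
    intro c hc
    obtain ⟨d, hd, hdc⟩ := NN_low hG hKG m c hc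
    exact (hmin d hd).trans ((Rr_le_iff m.ne m.cv hb hd c).2 hdc))
  have hsing : ∀ w ∈ K, w = x := by
    intro w hw
    apply AEEqFun.ext
    filter_upwards [(nsub_le_iff _ _ _).1 ((hxr w hw).trans h0),
      AEEqFun.coeFn_zero (α := Ω) (β := ℝ) (μ := P)] with ω h1 h2
    rw [h2] at h1
    exact sub_eq_zero.1 (norm_le_zero_iff.1 h1)
  exact ⟨x, hx, fun T hT => hsing _ (m.maps T hT hx)⟩

theorem main_aux [IsProbabilityMeasure P]
    (G : Set (Ω →ₘ[P] B)) (hG : ConvexlyCompact G) (hns : RandNormalStructure G)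
    (𝒯 : Set ((Ω →ₘ[P] B) → (Ω →ₘ[P] B)))
    (hmaps : ∀ T ∈ 𝒯, Set.MapsTo T G G)
    (hnonexp : ∀ T ∈ 𝒯, NonexpansiveOn G T)
    (hcomm : ∀ T ∈ 𝒯, ∀ S ∈ 𝒯, ∀ x ∈ G, T (S x) = S (T x))
    (hdense : ∀ T ∈ 𝒯, seqClosure (T '' G) = G) :
    ∃ x ∈ Cc G G, ∀ T ∈ 𝒯, T x = x := by
  have hb := bounded_of_compact hG
  obtain ⟨hne, hcl, hcv, -⟩ := id hG
  obtain ⟨x0, hx0, hmin⟩ := cheb_min hG Subset.rfl hne hcl hcv hb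
  have hleast : IsGLB ((fun x => Rr G x) '' G) (Rr G x0) := by
    refine IsLeast.isGLB ⟨⟨x0, hx0, rfl⟩, ?_⟩
    rintro _ ⟨y, hy, rfl⟩
    exact hmin y hy
  have hRS : RrS G G = Rr G x0 := (linf_isGLB ⟨_, hleast⟩).unique hleast
  set C := {x ∈ G | ∀ y ∈ G, nrm (y - x) ≤ Rr G x0} with hC
  have hCc : C ⊆ Cc G G := by
    rintro x ⟨hx, hx2⟩
    refine ⟨hx, ?_⟩
    rw [hRS]
    exact le_antisymm ((Rr_le_iff hne hcv hb hx _).2 hx2) (hmin x hx)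
  have hCG : C ⊆ G := fun x hx => hx.1
  have hCne : C.Nonempty := ⟨x0, hx0, (Rr_le_iff hne hcv hb hx0 _).1 le_rfl⟩
  have hCmaps : ∀ T ∈ 𝒯, MapsTo T C C := by
    rintro T hT x ⟨hx, hx2⟩
    refine ⟨hmaps T hT hx, fun y hy => ?_⟩
    rw [nsub_comm]
    refine cl_sub (S := T '' G) (ball_closed (T x) (Rr G x0)) ?_ ((hdense T hT).symm ▸ hy)
    rintro _ ⟨w, hw, rfl⟩
    change nrm (T x - T w) ≤ _
    rw [nsub_comm]
    exact (hnonexp T hT w hw x hx).trans (hx2 w hw)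
  let 𝒦 : Set (Set (Ω →ₘ[P] B)) :=
    {K | K ⊆ C ∧ K.Nonempty ∧ SeqClosed K ∧ LConvex K ∧ ∀ T ∈ 𝒯, MapsTo T K K}
  obtain ⟨K, hKC, hK⟩ := zorn_superset_nonempty 𝒦 (by
      intro c hc hchain hcne
      refine ⟨⋂₀ c, ⟨?_, ?_, sInter_closed fun D hD => (hc hD).2.2.1,
        sInter_conv fun D hD => (hc hD).2.2.2.1, ?_⟩, fun s hs => sInter_subset_of_mem hs⟩
      · obtain ⟨D, hD⟩ := hcne
        exact (sInter_subset_of_mem hD).trans (hc hD).1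
      · refine compact_dir hG (fun D hD => ⟨(hc hD).2.1, (hc hD).1.trans hCG, (hc hD).2.2.1,
          (hc hD).2.2.2.1⟩) ?_
        intro D hD E hE
        rcases hchain.total hD hE with h | h
        · exact ⟨D, hD, Subset.rfl, h⟩
        · exact ⟨E, hE, h, Subset.rfl⟩
      · intro T hT x hx D hD
        exact (hc hD).2.2.2.2 T hT (hx D hD)) C
    ⟨Subset.rfl, hCne, cheb_closed hcl G _, cheb_conv hcv G _, hCmaps⟩
  have hKG : K ⊆ G := hKC.trans hCG
  obtain ⟨hK0, hK1, hK2, hK3, hK4⟩ := hK.prop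
  have m : MinSet 𝒯 K :=
    { ne := hK1
      cl := hK2
      cv := hK3
      maps := hK4
      nonexp := fun T hT x hx y hy => hnonexp T hT x (hKG hx) y (hKG hy)
      comm := fun T hT S hS x hx => hcomm T hT S hS x (hKG hx)
      min := fun K' hK' h1 h2 h3 h4 =>
        hK.le_of_le (y := K') ⟨hK'.trans hKC, h1, h2, h3, h4⟩ hK' }
  obtain ⟨x, hx, hfix⟩ := fixed_of_min hG hns hKG m (by
    obtain ⟨ξ, hξ⟩ := hb
    exact ⟨ξ, fun h hh => hξ h (hKG hh)⟩)
  exact ⟨x, hCc (hKC hx), hfix⟩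

/-- A commutative family of nonexpansive self-mappings of an `L⁰`-convexly compact set `G`
with random normal structure, each with `T(G)` dense in `G` (closure under convergence in
probability equal to `G`), has a common fixed point in the random Chebyshev center. -/
theorem common_fixed_point_of_commutative_nonexpansive_dense_range
    {Ω : Type*} [MeasurableSpace Ω] {P : Measure Ω} [IsProbabilityMeasure P]
    {B : Type*} [NormedAddCommGroup B] [NormedSpace ℝ B] [CompleteSpace B]
    (G : Set (Ω →ₘ[P] B)) (hG : ConvexlyCompact G) (hns : RandNormalStructure G)
    (𝒯 : Set ((Ω →ₘ[P] B) → (Ω →ₘ[P] B)))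
    (hmaps : ∀ T ∈ 𝒯, Set.MapsTo T G G)
    (hnonexp : ∀ T ∈ 𝒯, NonexpansiveOn G T)
    (hcomm : ∀ T ∈ 𝒯, ∀ S ∈ 𝒯, ∀ x ∈ G, T (S x) = S (T x))
    (hdense : ∀ T ∈ 𝒯, seqClosure (T '' G) = G) :
    ∃ x ∈ Cc G G, ∀ T ∈ 𝒯, T x = x := by
  exact main_aux G hG hns 𝒯 hmaps hnonexp hcomm hdense

end RNM
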